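/- arXiv:1503.05739 — 2 statements merged into one kernel-verified Lean document; each statement's English description precedes it below -/
import Mathlib

section
/- Let P ⊂ ℝ⁴ be a 4-dimensional reflexive polytope. Then P is a CL-polytope if and only if either (i) vol(P) = 16 and |P ∩ ℤ⁴| = 81, or (ii) 5·vol(P) < |P ∩ ℤ⁴| − 1, 2|P ∩ ℤ⁴| ≤ 9(vol(P) + 2), and (|P ∩ ℤ⁴| − 1 − 4·vol(P))² ≥ 16·vol(P). -/
open Pointwise MeasureTheory Polynomial

noncomputable section

/-- The lattice points of a subset `S ⊆ ℝ^d`: integer vectors whose real cast lies in `S`. -/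
def latticePts (d : ℕ) (S : Set (Fin d → ℝ)) : Set (Fin d → ℤ) :=
  {x | (fun i => (x i : ℝ)) ∈ S}

/-- `P ⊆ ℝ^d` is a lattice polytope: the convex hull of finitely many integer points. -/
def IsLatticePolytope (d : ℕ) (P : Set (Fin d → ℝ)) : Prop :=
  ∃ V : Finset (Fin d → ℤ),
    P = convexHull ℝ ((fun v : Fin d → ℤ => fun i => (v i : ℝ)) '' (V : Set (Fin d → ℤ)))

/-- `P` is full-dimensional in `ℝ^d`. -/
def IsFullDim (d : ℕ) (P : Set (Fin d → ℝ)) : Prop :=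
  affineSpan ℝ P = ⊤

/-- `L` is the Ehrhart polynomial of `P`: `L(m) = |mP ∩ ℤ^d|` for every natural number `m`. -/
def IsEhrhart (d : ℕ) (P : Set (Fin d → ℝ)) (L : Polynomial ℚ) : Prop :=
  ∀ m : ℕ, L.eval (m : ℚ) = ((latticePts d ((m : ℝ) • P)).ncard : ℚ)

/-- The complex roots of a rational polynomial, counted with multiplicity. -/
def cRoots (L : Polynomial ℚ) : Multiset ℂ :=
  (L.map (algebraMap ℚ ℂ)).roots

/-- `L` is a CL-polynomial: every complex root has real part `-1/2`. -/
def IsCL (L : Polynomial ℚ) : Prop :=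
  ∀ z ∈ cRoots L, z.re = -(1/2 : ℝ)

/-- `L` has only real roots: every complex root has imaginary part `0`. -/
def IsRealRooted (L : Polynomial ℚ) : Prop :=
  ∀ z ∈ cRoots L, z.im = 0

/-- The dual (polar) body `{u : ⟨u,v⟩ ≥ -1 for all v ∈ P}`. -/
def dualBody (d : ℕ) (P : Set (Fin d → ℝ)) : Set (Fin d → ℝ) :=
  {u | ∀ v ∈ P, -1 ≤ ∑ i, u i * v i}

/-- `P` is reflexive: the origin is interior and the dual body is a lattice polytope. -/
def IsReflexive (d : ℕ) (P : Set (Fin d → ℝ)) : Prop :=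
  (0 : Fin d → ℝ) ∈ interior P ∧ IsLatticePolytope d (dualBody d P)

/-- The Euclidean volume of `P ⊆ ℝ^d`. -/
def vol (d : ℕ) (P : Set (Fin d → ℝ)) : ℝ :=
  (volume P).toReal

/-- `δ` is the δ-vector of the Ehrhart polynomial `L` in dimension `d`:
`L(m) = ∑_{j=0}^d δ_j C(d+m-j, d)` for all natural numbers `m`. -/
def HasDeltaVector (d : ℕ) (L : Polynomial ℚ) (δ : Fin (d+1) → ℤ) : Prop :=
  ∀ m : ℕ, L.eval (m : ℚ) = ∑ j : Fin (d+1), (δ j : ℚ) * (Nat.choose (d + m - (j : ℕ)) d : ℚ)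

/-- The discriminant `B²C² − 4AC³ − 4B³D − 27A²D² + 18ABCD` of the cubic `Az³+Bz²+Cz+D`. -/
def cubicDisc (A B C D : ℚ) : ℚ :=
  B^2*C^2 - 4*A*C^3 - 4*B^3*D - 27*A^2*D^2 + 18*A*B*C*D


/-! ### Bases extracted from a finite family of vectors -/

/-- A basis of `E` consisting of members of the family `w`, recorded by its index set and by its
coordinate map, the latter extended by zero to the whole index type. -/
structure SubfamilyBasis {ι E : Type*} [Fintype ι] [AddCommGroup E] [Module ℝ E] (w : ι → E) where
  supp : Finset ι
  coord : E →ₗ[ℝ] (ι → ℝ)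
  coord_of_notMem : ∀ x, ∀ i ∉ supp, coord x i = 0
  sum_coord : ∀ x, ∑ i, coord x i • w i = x
  coord_sum : ∀ a : ι → ℝ, (∀ i ∉ supp, a i = 0) → coord (∑ i, a i • w i) = a

namespace SubfamilyBasis

variable {ι E : Type*} [Fintype ι] [AddCommGroup E] [Module ℝ E] {w : ι → E}

theorem supp_injective : Function.Injective (supp : SubfamilyBasis w → Finset ι) := by
  rintro ⟨s, f, hf, hs, hu⟩ ⟨t, g, hg, ht, hv⟩ h
  obtain rfl : s = t := h
  have : f = g := by
    ext1 x
    conv_lhs => rw [← ht x]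
    exact hu _ (hg x)
  subst this
  rfl

instance : Finite (SubfamilyBasis w) := Finite.of_injective _ supp_injective

noncomputable instance : Fintype (SubfamilyBasis w) := Fintype.ofFinite _

variable (b : SubfamilyBasis w)

theorem coord_apply_of_mem [DecidableEq ι] {i : ι} (hi : i ∈ b.supp) :
    b.coord (w i) = Pi.single i 1 := by
  have := b.coord_sum (Pi.single i 1) (fun j hj => by
    rw [Pi.single_eq_of_ne]; rintro rfl; exact hj hi)
  rwa [Finset.sum_eq_single i (fun j _ hj => by simp [hj]) (by simp), Pi.single_eq_same,
    one_smul] at this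

theorem coord_injective : Function.Injective b.coord := fun x y h => by
  rw [← b.sum_coord x, ← b.sum_coord y, h]

theorem sum_single_sub_coord [DecidableEq ι] (j : ι) :
    ∑ k, (Pi.single j 1 - b.coord (w j) : ι → ℝ) k • w k = 0 := by
  simp only [Pi.sub_apply, sub_smul, Finset.sum_sub_distrib, b.sum_coord]
  rw [Finset.sum_eq_single j (fun k _ hk => by simp [hk]) (by simp)]
  simp

/-- Exchange the basis element `i` for the vector `w j`. -/
noncomputable def exchange [DecidableEq ι] (i j : ι) (hj : j ∉ b.supp) (h : b.coord (w j) i ≠ 0) :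
    SubfamilyBasis w where
  supp := insert j (b.supp.erase i)
  coord := b.coord + (LinearMap.toSpanSingleton ℝ (ι → ℝ)
    ((b.coord (w j) i)⁻¹ • (Pi.single j 1 - b.coord (w j)))).comp
      ((LinearMap.proj i : (ι → ℝ) →ₗ[ℝ] ℝ).comp b.coord)
  coord_of_notMem x k hk := by
    have hkj : k ≠ j := by rintro rfl; simp at hk
    by_cases hki : k = i
    · subst hki
      simp [hkj]
      field_simp
      ring
    · have : k ∉ b.supp := by simpa [hkj, hki] using hk
      simp [hkj, b.coord_of_notMem _ _ this]
  sum_coord x := by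
    have h0 := b.sum_single_sub_coord j
    simp only [LinearMap.add_apply, Pi.add_apply, add_smul, Finset.sum_add_distrib, b.sum_coord,
      LinearMap.comp_apply, LinearMap.toSpanSingleton_apply, Pi.smul_apply, smul_assoc,
      ← Finset.smul_sum, h0, smul_zero, add_zero]
  coord_sum a ha := by
    have hij : i ≠ j := by
      rintro rfl; exact h (b.coord_of_notMem _ _ hj)
    have hai : a i = 0 := ha i (by simp [hij])
    have e : ∑ k, a k • w k
        = ∑ k, (a - a j • (Pi.single j 1 - b.coord (w j)) : ι → ℝ) k • w k := by
      have h0 := b.sum_single_sub_coord j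
      simp only [Pi.sub_apply a, sub_smul, Finset.sum_sub_distrib, Pi.smul_apply, smul_assoc,
        ← Finset.smul_sum, h0, smul_zero, sub_zero]
    have hc : b.coord (∑ k, a k • w k) = a - a j • (Pi.single j 1 - b.coord (w j)) := by
      rw [e]
      apply b.coord_sum
      intro k hk
      by_cases hkj : k = j
      · subst hkj
        simp [b.coord_of_notMem _ _ hj]
      · have : a k = 0 := ha k (by simp [hkj, hk])
        simp [hkj, this, b.coord_of_notMem _ _ hk]
    rw [LinearMap.add_apply, LinearMap.comp_apply, LinearMap.comp_apply, hc]
    ext k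
    simp [hij, hai]
    field_simp
    ring

theorem exchange_coord [DecidableEq ι] (i j : ι) (hj : j ∉ b.supp) (h : b.coord (w j) i ≠ 0)
    (x : E) (k : ι) : (b.exchange i j hj h).coord x k =
      b.coord x k + b.coord x i / b.coord (w j) i * ((Pi.single j 1 : ι → ℝ) k - b.coord (w j) k) := by
  simp [exchange]
  ring

/-- A linearly independent subfamily of a spanning family extends to a basis. -/
theorem exists_superset (hw : Submodule.span ℝ (Set.range w) = ⊤) (s : Set ι)
    (hs : LinearIndepOn ℝ w s) : ∃ b : SubfamilyBasis w, s ⊆ b.supp := by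
  classical
  obtain ⟨t, -, hst, hspan, hli⟩ := exists_linearIndepOn_extension hs (Set.subset_univ s)
  have htop : ⊤ ≤ Submodule.span ℝ (Set.range fun i : t => w i) := by
    rw [← hw, Submodule.span_le, ← Set.image_univ]
    rwa [Set.image_eq_range w t] at hspan
  let β : Module.Basis t ℝ E := Module.Basis.mk hli htop
  have hβ : ∀ i : t, β i = w i := fun i => Module.Basis.mk_apply hli htop i
  have key : ∀ a : ι → ℝ, (∀ i ∉ t, a i = 0) → ∑ i, a i • w i = ∑ i : t, a i • β i := by
    intro a ha
    simp only [hβ]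
    rw [← Finset.sum_subset (Finset.subset_univ t.toFinset), ← Finset.sum_coe_sort]
    · exact Fintype.sum_equiv (Equiv.subtypeEquivRight (by simp)) _ _ (fun _ => rfl)
    · intro i _ hi
      rw [ha i (by simpa using hi), zero_smul]
  refine ⟨⟨t.toFinset, LinearMap.pi fun i => if h : i ∈ t then β.coord ⟨i, h⟩ else 0,
    ?_, ?_, ?_⟩, by simpa using hst⟩
  · intro x i hi
    have : i ∉ t := by simpa using hi
    simp [this]
  · intro x
    rw [key _ (fun i hi => by simp [hi])]
    conv_rhs => rw [← β.sum_repr x]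
    simp
  · intro a ha
    have ha' : ∀ i ∉ t, a i = 0 := fun i hi => ha i (by simpa using hi)
    rw [key a ha']
    ext i
    by_cases hi : i ∈ t
    · simp only [LinearMap.pi_apply, hi, dif_pos, Module.Basis.coord_apply]
      rw [β.repr_sum_self (fun i : t => a i)]
    · simp [hi, ha' i hi]

end SubfamilyBasis

/-! ### Regular triangulations of a complete fan -/

/-- An affine function of `ε` whose first nonzero coefficient is positive is positive for all
sufficiently small `ε > 0`. -/
theorem eventually_add_mul_pos {p q : ℝ} (h : 0 < p ∨ p = 0 ∧ 0 < q) :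
    ∀ᶠ ε in nhdsWithin (0 : ℝ) (Set.Ioi 0), 0 < p + ε * q := by
  rcases h with h | ⟨rfl, h⟩
  · have hcont : ContinuousAt (fun ε : ℝ => p + ε * q) 0 := by fun_prop
    exact (continuousAt_const.eventually_lt hcont (by simpa using h)).filter_mono
      nhdsWithin_le_nhds
  · filter_upwards [self_mem_nhdsWithin] with ε hε
    have : (0 : ℝ) < ε := hε
    positivity

theorem eventually_add_mul_neg {p q : ℝ} (h : p < 0 ∨ p = 0 ∧ q < 0) :
    ∀ᶠ ε in nhdsWithin (0 : ℝ) (Set.Ioi 0), p + ε * q < 0 := by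
  filter_upwards [eventually_add_mul_pos (p := -p) (q := -q) (by simpa using h)] with ε hε
  linarith

/-- A nonnegative combination can be moved along a relation until a coefficient vanishes. -/
theorem exists_ratio_test {ι : Type*} (s : Finset ι) (a g : ι → ℝ) (ha : ∀ i ∈ s, 0 ≤ a i)
    (hg : ∃ i ∈ s, 0 < g i) :
    ∃ i ∈ s, 0 < g i ∧ ∀ k ∈ s, 0 ≤ a k - a i / g i * g k := by
  classical
  obtain ⟨i, hi, hmin⟩ := Finset.exists_min_image (s.filter fun i => 0 < g i)
    (fun i => a i / g i) (by
      obtain ⟨i, hi, h⟩ := hg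
      exact ⟨i, by simp [hi, h]⟩)
  rw [Finset.mem_filter] at hi
  refine ⟨i, hi.1, hi.2, fun k hk => ?_⟩
  have hpos : 0 ≤ a i / g i := div_nonneg (ha i hi.1) hi.2.le
  rcases le_or_gt (g k) 0 with h | h
  · have := ha k hk
    nlinarith [mul_nonneg hpos (neg_nonneg.2 h)]
  · have := hmin k (by simp [hk, h])
    rw [le_div_iff₀ h] at this
    linarith

section Triangulation

variable {ι E : Type*} [Fintype ι] [AddCommGroup E] [Module ℝ E] {w : ι → E}

/-- Carathéodory's theorem for cones. -/
theorem exists_nonneg_linearIndepOn (x : E)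
    (hx : ∃ a : ι → ℝ, (∀ i, 0 ≤ a i) ∧ ∑ i, a i • w i = x) :
    ∃ a : ι → ℝ, (∀ i, 0 ≤ a i) ∧ ∑ i, a i • w i = x ∧ LinearIndepOn ℝ w {i | a i ≠ 0} := by
  classical
  let p : ℕ → Prop := fun n => ∃ a : ι → ℝ, (∀ i, 0 ≤ a i) ∧ ∑ i, a i • w i = x ∧
    (Finset.univ.filter fun i => a i ≠ 0).card = n
  have hp : ∃ n, p n := by
    obtain ⟨a, h0, h1⟩ := hx
    exact ⟨_, a, h0, h1, rfl⟩
  obtain ⟨a, h0, h1, hn⟩ := Nat.find_spec hp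
  refine ⟨a, h0, h1, ?_⟩
  by_contra hdep
  have hrel : ∃ g : ι → ℝ, (∀ i, a i = 0 → g i = 0) ∧ ∑ i, g i • w i = 0 ∧ ∃ i, 0 < g i := by
    have hdep' : ¬ LinearIndepOn ℝ w
        ((Finset.univ.filter fun i => a i ≠ 0 : Finset ι) : Set ι) := by simpa using hdep
    rw [linearIndepOn_finset_iff] at hdep'
    push Not at hdep'
    obtain ⟨g, hg, i, hi, hgi⟩ := hdep'
    have hgs : ∑ k, (if a k ≠ 0 then g k else 0) • w k = 0 := by
      rw [← hg, Finset.sum_filter]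
      refine Finset.sum_congr rfl fun k _ => ?_
      split_ifs <;> simp
    have hai : a i ≠ 0 := by simpa using hi
    rcases hgi.lt_or_gt with h | h
    · refine ⟨fun k => - (if a k ≠ 0 then g k else 0), fun k hk => by simp [hk], ?_, i, ?_⟩
      · simp only [neg_smul, Finset.sum_neg_distrib, hgs, neg_zero]
      · simpa [hai] using h
    · exact ⟨fun k => if a k ≠ 0 then g k else 0, fun k hk => by simp [hk], hgs, i,
        by simpa [hai] using h⟩
  obtain ⟨g, hg0, hgs, hgp⟩ := hrel
  obtain ⟨i, -, hi, hnn⟩ := exists_ratio_test Finset.univ a g (fun i _ => h0 i)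
    (by simpa using hgp)
  refine Nat.find_min hp (m := (Finset.univ.filter
    fun k => a k - a i / g i * g k ≠ 0).card) ?_ ⟨fun k => a k - a i / g i * g k,
      fun k => hnn k (Finset.mem_univ _), ?_, rfl⟩
  · rw [← hn]
    refine Finset.card_lt_card ⟨?_, ?_⟩
    · intro k hk
      rw [Finset.mem_filter] at hk ⊢
      refine ⟨hk.1, fun h => hk.2 ?_⟩
      simp [h, hg0 k h]
    · intro hsub
      have : i ∈ Finset.univ.filter fun i => a i ≠ 0 := by
        simp only [Finset.mem_filter, Finset.mem_univ, true_and]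
        intro h
        exact hi.ne' (hg0 i h)
      have := hsub this
      simp [hi.ne'] at this
  · simp only [sub_smul, Finset.sum_sub_distrib, mul_smul, ← Finset.smul_sum, h1, hgs]
    simp

namespace SubfamilyBasis

variable (w) in
/-- `x` lies on no hyperplane spanned by members of the family. -/
def IsGenericPoint (x : E) : Prop :=
  ∀ b : SubfamilyBasis w, ∀ i ∈ b.supp, b.coord x i ≠ 0

/-- `x` lies in the open cone spanned by the basis. -/
def InOpenCone (b : SubfamilyBasis w) (x : E) : Prop :=
  ∀ i ∈ b.supp, 0 < b.coord x i

/-- The linear functional taking the value `ω i` at each basis element `w i`. -/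
def cost (b : SubfamilyBasis w) (ω : ι → ℝ) (x : E) : ℝ := ∑ i, b.coord x i * ω i

/-- The lifting `ω` of the family lies above the linear functional determined by the basis. -/
def IsFeasible (b : SubfamilyBasis w) (ω : ι → ℝ) : Prop := ∀ j, b.cost ω (w j) ≤ ω j

theorem cost_apply_of_mem (b : SubfamilyBasis w) (ω : ι → ℝ) {i : ι} (hi : i ∈ b.supp) :
    b.cost ω (w i) = ω i := by
  classical
  simp [cost, b.coord_apply_of_mem hi, Pi.single_apply]

theorem cost_eq_sum (b c : SubfamilyBasis w) (ω : ι → ℝ) (x : E) :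
    c.cost ω x = ∑ i, b.coord x i * c.cost ω (w i) := by
  conv_lhs => rw [← b.sum_coord x]
  simp only [cost, map_sum, map_smul, Finset.sum_apply, Pi.smul_apply, smul_eq_mul,
    Finset.sum_mul, Finset.mul_sum]
  rw [Finset.sum_comm]
  simp only [mul_assoc]

theorem InOpenCone.coord_nonneg {b : SubfamilyBasis w} {x : E} (h : b.InOpenCone x) (i : ι) :
    0 ≤ b.coord x i := by
  by_cases hi : i ∈ b.supp
  · exact (h i hi).le
  · exact (b.coord_of_notMem x i hi).ge

theorem IsFeasible.cost_le {b c : SubfamilyBasis w} {ω : ι → ℝ} (hc : c.IsFeasible ω) {x : E}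
    (hx : b.InOpenCone x) : c.cost ω x ≤ b.cost ω x := by
  rw [cost_eq_sum b c]
  exact Finset.sum_le_sum fun i _ => mul_le_mul_of_nonneg_left (hc i) (hx.coord_nonneg i)

theorem IsFeasible.eq_of_inOpenCone {b c : SubfamilyBasis w} {ω : ι → ℝ}
    (hω : ∀ b : SubfamilyBasis w, ∀ j ∉ b.supp, b.cost ω (w j) ≠ ω j)
    (hb : b.IsFeasible ω) (hc : c.IsFeasible ω) {x : E}
    (hbx : b.InOpenCone x) (hcx : c.InOpenCone x) : b = c := by
  have key : ∀ {b c : SubfamilyBasis w}, b.IsFeasible ω → c.IsFeasible ω → b.InOpenCone x →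
      c.InOpenCone x → b.supp ⊆ c.supp := by
    intro b c hb hc hbx hcx i hi
    by_contra hic
    have hlt : c.cost ω (w i) < ω i := lt_of_le_of_ne (hc i) (hω c i hic)
    have : c.cost ω x < b.cost ω x := by
      rw [cost_eq_sum b c]
      exact Finset.sum_lt_sum
        (fun i _ => mul_le_mul_of_nonneg_left (hc i) (hbx.coord_nonneg i))
        ⟨i, Finset.mem_univ _, mul_lt_mul_of_pos_left hlt (hbx i hi)⟩
    exact this.not_ge (hb.cost_le hcx)
  exact supp_injective ((key hb hc hbx hcx).antisymm (key hc hb hcx hbx))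

theorem exists_inOpenCone (hw : ∀ x : E, ∃ a : ι → ℝ, (∀ i, 0 ≤ a i) ∧ ∑ i, a i • w i = x)
    {x : E} (hx : IsGenericPoint w x) : ∃ b : SubfamilyBasis w, b.InOpenCone x := by
  have hspan : Submodule.span ℝ (Set.range w) = ⊤ := by
    rw [eq_top_iff]
    rintro y -
    obtain ⟨a, -, rfl⟩ := hw y
    exact Submodule.sum_mem _ fun i _ =>
      Submodule.smul_mem _ _ (Submodule.subset_span ⟨i, rfl⟩)
  obtain ⟨a, ha, hax, hli⟩ := exists_nonneg_linearIndepOn x (hw x)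
  obtain ⟨b, hb⟩ := exists_superset hspan _ hli
  have hcoord : b.coord x = a := by
    rw [← hax]
    refine b.coord_sum a fun i hi => ?_
    by_contra h
    exact hi (hb h)
  exact ⟨b, fun i hi => lt_of_le_of_ne (hcoord ▸ ha i) (hx b i hi).symm⟩

theorem exists_isFeasible_inOpenCone
    (hw : ∀ x : E, ∃ a : ι → ℝ, (∀ i, 0 ≤ a i) ∧ ∑ i, a i • w i = x)
    {ω : ι → ℝ} (hω : ∀ i, 0 < ω i) {x : E} (hx : IsGenericPoint w x) :
    ∃ b : SubfamilyBasis w, b.IsFeasible ω ∧ b.InOpenCone x := by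
  classical
  obtain ⟨b, hb, hmin⟩ := Finset.exists_min_image
    (Finset.univ.filter fun b : SubfamilyBasis w => b.InOpenCone x) (fun b => b.cost ω x) (by
      obtain ⟨b, hb⟩ := exists_inOpenCone hw hx
      exact ⟨b, by simpa using hb⟩)
  simp only [Finset.mem_filter, Finset.mem_univ, true_and] at hb hmin
  refine ⟨b, fun j => ?_, hb⟩
  by_contra! hj
  have hjb : j ∉ b.supp := fun h => hj.ne' (b.cost_apply_of_mem ω h)
  have hpos : ∃ i ∈ b.supp, 0 < b.coord (w j) i := by
    by_contra! hneg
    have : b.cost ω (w j) ≤ 0 := by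
      refine Finset.sum_nonpos fun i _ => mul_nonpos_of_nonpos_of_nonneg ?_ (hω i).le
      by_cases hi : i ∈ b.supp
      · exact hneg i hi
      · exact (b.coord_of_notMem _ i hi).le
    linarith [hω j]
  obtain ⟨i, hi, hgi, hk⟩ := exists_ratio_test b.supp (b.coord x) (b.coord (w j))
    (fun i hi => (hb i hi).le) hpos
  let c := b.exchange i j hjb hgi.ne'
  have hc : c.InOpenCone x := by
    intro k hkc
    refine lt_of_le_of_ne ?_ (hx c k hkc).symm
    rw [exchange_coord]
    by_cases hkj : k = j
    · subst hkj
      rw [b.coord_of_notMem _ _ hjb, b.coord_of_notMem _ _ hjb]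
      simpa using div_nonneg (hb i hi).le hgi.le
    · have hkb : k ∈ b.supp := by
        have : k ∈ insert j (b.supp.erase i) := hkc
        simp only [Finset.mem_insert, hkj, false_or, Finset.mem_erase] at this
        exact this.2
      have := hk k hkb
      simp only [Pi.single_eq_of_ne hkj, zero_sub]
      linarith
  have hcost : c.cost ω x
      = b.cost ω x + b.coord x i / b.coord (w j) i * (ω j - b.cost ω (w j)) := by
    simp only [cost, c, exchange_coord, add_mul, mul_assoc, sub_mul, Finset.sum_add_distrib,
      ← Finset.mul_sum, Finset.sum_sub_distrib]
    simp [Pi.single_apply]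
  have h1 := hmin c hc
  have h2 : 0 < b.coord x i / b.coord (w j) i := div_pos (hb i hi) hgi
  rw [hcost] at h1
  nlinarith

variable (w) in
theorem exists_isGenericPoint : ∃ x : E, IsGenericPoint w x := by
  classical
  obtain ⟨x, hx⟩ := Module.Dual.exists_forall_ne_zero_of_forall_exists (K := ℝ) (M := E)
    (fun p : (Σ b : SubfamilyBasis w, b.supp) =>
      (LinearMap.proj (p.2 : ι) : (ι → ℝ) →ₗ[ℝ] ℝ).comp p.1.coord) (by
      rintro ⟨b, i, hi⟩
      exact ⟨w i, by simp [b.coord_apply_of_mem hi]⟩)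
  exact ⟨x, fun b i hi => hx ⟨b, i, hi⟩⟩

variable (w) in
/-- A generic lifting close to the constant one: it defines a triangulation which refines the
fan of faces. -/
theorem exists_generic_lifting : ∃ ω : ι → ℝ, (∀ i, 0 < ω i) ∧
    (∀ b : SubfamilyBasis w, ∀ j ∉ b.supp, b.cost ω (w j) ≠ ω j) ∧
    ∀ b : SubfamilyBasis w, b.IsFeasible ω → b.IsFeasible 1 := by
  classical
  have hadd : ∀ (b : SubfamilyBasis w) (c : ι → ℝ) (ε : ℝ) x,
      b.cost (1 + ε • c) x = b.cost 1 x + ε * b.cost c x := by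
    intro b c ε x
    simp only [cost, Pi.add_apply, Pi.smul_apply, smul_eq_mul, mul_add, Finset.sum_add_distrib,
      Finset.mul_sum]
    congr 1
    exact Finset.sum_congr rfl fun i _ => by ring
  obtain ⟨c, hc⟩ := Module.Dual.exists_forall_ne_zero_of_forall_exists (K := ℝ) (M := ι → ℝ)
    (fun p : (Σ b : SubfamilyBasis w, {j // j ∉ b.supp}) =>
      (LinearMap.proj (p.2 : ι) : (ι → ℝ) →ₗ[ℝ] ℝ) -
        ∑ i, p.1.coord (w p.2) i • (LinearMap.proj i : (ι → ℝ) →ₗ[ℝ] ℝ)) (by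
      rintro ⟨b, j, hj⟩
      refine ⟨Pi.single j 1, ?_⟩
      simp [Pi.single_apply, b.coord_of_notMem _ _ hj])
  have hc' : ∀ b : SubfamilyBasis w, ∀ j ∉ b.supp, c j - b.cost c (w j) ≠ 0 := by
    intro b j hj
    simpa [cost] using hc ⟨b, j, hj⟩
  have ev : ∀ᶠ ε in nhdsWithin (0 : ℝ) (Set.Ioi 0), (∀ i, 0 < 1 + ε * c i) ∧
      ∀ b : SubfamilyBasis w, ∀ j,
        (j ∉ b.supp → (1 - b.cost 1 (w j)) + ε * (c j - b.cost c (w j)) ≠ 0) ∧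
        (1 - b.cost 1 (w j) < 0 → (1 - b.cost 1 (w j)) + ε * (c j - b.cost c (w j)) < 0) := by
    rw [Filter.eventually_and, Filter.eventually_all, Filter.eventually_all]
    refine ⟨fun i => eventually_add_mul_pos (by simp), fun b => ?_⟩
    rw [Filter.eventually_all]
    intro j
    rw [Filter.eventually_and]
    constructor
    · by_cases hj : j ∈ b.supp
      · simp [hj]
      have h := hc' b j hj
      rcases lt_trichotomy (1 - b.cost 1 (w j)) 0 with h1 | h1 | h1
      · filter_upwards [eventually_add_mul_neg (q := c j - b.cost c (w j)) (Or.inl h1)]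
          with ε hε _ using hε.ne
      · rcases h.lt_or_gt with h2 | h2
        · filter_upwards [eventually_add_mul_neg (Or.inr ⟨h1, h2⟩)] with ε hε _ using hε.ne
        · filter_upwards [eventually_add_mul_pos (Or.inr ⟨h1, h2⟩)] with ε hε _ using hε.ne'
      · filter_upwards [eventually_add_mul_pos (q := c j - b.cost c (w j)) (Or.inl h1)]
          with ε hε _ using hε.ne'
    · by_cases h1 : 1 - b.cost 1 (w j) < 0
      · filter_upwards [eventually_add_mul_neg (q := c j - b.cost c (w j)) (Or.inl h1)]
          with ε hε _ using hε
      · simp [h1]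
  obtain ⟨ε, h0, h1⟩ := ev.exists
  refine ⟨1 + ε • c, by simpa using h0, fun b j hj => ?_, fun b hb j => ?_⟩
  · have := (h1 b j).1 hj
    rw [hadd]
    intro h
    apply this
    simp only [Pi.add_apply, Pi.one_apply, Pi.smul_apply, smul_eq_mul] at h
    linarith
  · by_contra! hlt
    have := (h1 b j).2 (by simp only [Pi.one_apply] at hlt; linarith)
    have h2 := hb j
    rw [hadd] at h2
    simp only [Pi.add_apply, Pi.one_apply, Pi.smul_apply, smul_eq_mul] at h2
    linarith

/-- The half-open cone of the points `x` such that `x + ε v` lies in the open cone for all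
sufficiently small `ε > 0`. -/
def InHalfOpenCone (b : SubfamilyBasis w) (v x : E) : Prop :=
  ∀ i ∈ b.supp, 0 < b.coord x i ∨ b.coord x i = 0 ∧ 0 < b.coord v i

theorem IsGenericPoint.neg {v : E} (hv : IsGenericPoint w v) : IsGenericPoint w (-v) := by
  intro b i hi
  simpa using hv b i hi

/-- Half-open decomposition of the whole space into simplicial cones. -/
theorem exists_halfOpen_decomposition
    (hw : ∀ x : E, ∃ a : ι → ℝ, (∀ i, 0 ≤ a i) ∧ ∑ i, a i • w i = x) :
    ∃ T : Finset (SubfamilyBasis w), (∀ b ∈ T, b.IsFeasible 1) ∧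
      ∀ v, IsGenericPoint w v → ∀ x, ∃! b, b ∈ T ∧ b.InHalfOpenCone v x := by
  classical
  obtain ⟨ω, hpos, hgen, hfeas⟩ := exists_generic_lifting w
  refine ⟨Finset.univ.filter fun b => b.IsFeasible ω, fun b hb => hfeas b (by simpa using hb),
    fun v hv x => ?_⟩
  simp only [Finset.mem_filter, Finset.mem_univ, true_and]
  have ev : ∀ᶠ ε in nhdsWithin (0 : ℝ) (Set.Ioi 0), ∀ b : SubfamilyBasis w, ∀ i, i ∈ b.supp →
      (b.coord (x + ε • v) i ≠ 0 ∧ (0 < b.coord (x + ε • v) i ↔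
        0 < b.coord x i ∨ b.coord x i = 0 ∧ 0 < b.coord v i)) := by
    rw [Filter.eventually_all]
    intro b
    rw [Filter.eventually_all]
    intro i
    by_cases hi : i ∈ b.supp
    · simp only [hi, true_imp_iff, map_add, map_smul, Pi.add_apply, Pi.smul_apply, smul_eq_mul]
      by_cases h : 0 < b.coord x i ∨ b.coord x i = 0 ∧ 0 < b.coord v i
      · filter_upwards [eventually_add_mul_pos h] with ε hε
        exact ⟨hε.ne', by simp [hε, h]⟩
      · have h' : b.coord x i < 0 ∨ b.coord x i = 0 ∧ b.coord v i < 0 := by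
          rcases lt_trichotomy (b.coord x i) 0 with h1 | h1 | h1
          · exact Or.inl h1
          · refine Or.inr ⟨h1, lt_of_le_of_ne ?_ (hv b i hi)⟩
            by_contra! h2
            exact h (Or.inr ⟨h1, h2⟩)
          · exact absurd (Or.inl h1) h
        filter_upwards [eventually_add_mul_neg h'] with ε hε
        exact ⟨hε.ne, by simp [hε.le, h]⟩
    · simp [hi]
  obtain ⟨ε, hε⟩ := ev.exists
  have hiff : ∀ b : SubfamilyBasis w, b.InHalfOpenCone v x ↔ b.InOpenCone (x + ε • v) :=
    fun b => forall₂_congr fun i hi => (hε b i hi).2.symm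
  simp only [hiff]
  obtain ⟨b, hb, hbx⟩ := exists_isFeasible_inOpenCone hw hpos
    (x := x + ε • v) (fun b i hi => (hε b i hi).1)
  exact ⟨b, ⟨hb, hbx⟩, fun c hc => hc.1.eq_of_inOpenCone hgen hb hc.2 hbx⟩

end SubfamilyBasis

end Triangulation

/-! ### Lattice points in half-open simplicial cones -/

/-- The inclusion `ℤ^d → ℝ^d`. -/
def latticeEmbedding (d : ℕ) : (Fin d → ℤ) →+ (Fin d → ℝ) where
  toFun x i := (x i : ℝ)
  map_zero' := by ext; simp
  map_add' x y := by ext; simp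

theorem latticeEmbedding_injective (d : ℕ) : Function.Injective (latticeEmbedding d) := by
  intro x y h
  ext i
  exact Int.cast_injective (congrFun h i)

theorem finite_latticePts {d : ℕ} {S : Set (Fin d → ℝ)} (hS : Bornology.IsBounded S) :
    (latticePts d S).Finite := by
  obtain ⟨R, hR⟩ := hS.subset_closedBall 0
  refine (Set.finite_Icc (fun _ : Fin d => -⌈R⌉) (fun _ => ⌈R⌉)).subset fun x hx => ?_
  have h1 : ‖latticeEmbedding d x‖ ≤ R := mem_closedBall_zero_iff.1 (hR hx)
  have h2 : ∀ i, |(x i : ℝ)| ≤ ⌈R⌉ := fun i =>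
    ((norm_le_pi_norm (latticeEmbedding d x) i).trans h1).trans (Int.le_ceil R)
  exact ⟨fun i => by exact_mod_cast (abs_le.1 (h2 i)).1,
    fun i => by exact_mod_cast (abs_le.1 (h2 i)).2⟩

/-- Finitely supported functions `s → ℕ` of total at most `k`. -/
def boundedFinsupps {ι : Type*} [DecidableEq ι] (s : Finset ι) (k : ℤ) : Finset (ι →₀ ℕ) :=
  (Finset.range (k + 1).toNat).biUnion s.finsuppAntidiag

theorem mem_boundedFinsupps {ι : Type*} [DecidableEq ι] {s : Finset ι} {k : ℤ} {n : ι →₀ ℕ} :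
    n ∈ boundedFinsupps s k ↔ ((s.sum n : ℕ) : ℤ) ≤ k ∧ n.support ⊆ s := by
  simp only [boundedFinsupps, Finset.mem_biUnion, Finset.mem_range, Finset.mem_finsuppAntidiag]
  constructor
  · rintro ⟨a, ha, rfl, h⟩
    exact ⟨by omega, h⟩
  · rintro ⟨h1, h2⟩
    exact ⟨_, by omega, rfl, h2⟩

theorem card_boundedFinsupps {ι : Type*} [DecidableEq ι] {s : Finset ι} (hs : s.card = 4)
    {k : ℤ} (hk : -4 ≤ k) : ((boundedFinsupps s k).card : ℚ)
      = ((k : ℚ) + 1) * (k + 2) * (k + 3) * (k + 4) / 24 := by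
  have hcard : (boundedFinsupps s k).card
      = ∑ a ∈ Finset.range (k + 1).toNat, (a + 3).choose 3 := by
    rw [boundedFinsupps, Finset.card_biUnion]
    · refine Finset.sum_congr rfl fun a _ => ?_
      rw [Finset.card_finsuppAntidiag_nat_eq_choose, hs,
        show 4 + a - 1 = a + 3 by omega, ← Nat.choose_symm_add]
    · intro a _ b _ hab
      rw [Function.onFun, Finset.disjoint_left]
      intro n hn hn'
      rw [Finset.mem_finsuppAntidiag] at hn hn'
      exact hab (hn.1.symm.trans hn'.1)
  have hsum : ∀ n : ℕ, ((∑ a ∈ Finset.range n, (a + 3).choose 3 : ℕ) : ℚ)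
      = (n : ℚ) * (n + 1) * (n + 2) * (n + 3) / 24 := by
    intro n
    induction n with
    | zero => simp
    | succ n ih =>
      rw [Finset.sum_range_succ, Nat.cast_add, ih]
      have h3 : (((n + 3).choose 3 : ℕ) : ℚ) = ((n : ℚ) + 1) * (n + 2) * (n + 3) / 6 := by
        rw [Nat.cast_choose_eq_ascPochhammer_div]
        simp [ascPochhammer_succ_eval, Nat.factorial]
        ring
      rw [h3]
      push_cast
      ring
  rw [hcard, hsum]
  rcases le_or_gt 0 (k + 1) with h | h
  · have : (((k + 1).toNat : ℕ) : ℚ) = k + 1 := by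
      exact_mod_cast Int.toNat_of_nonneg h
    rw [this]
    ring
  · rw [Int.toNat_of_nonpos h.le]
    obtain rfl | rfl | rfl : k = -4 ∨ k = -3 ∨ k = -2 := by omega
    all_goals norm_num

namespace SubfamilyBasis

theorem card_supp {ι E : Type*} [Fintype ι] [AddCommGroup E] [Module ℝ E] {w : ι → E}
    (b : SubfamilyBasis w) : b.supp.card = Module.finrank ℝ E := by
  classical
  let f : E →ₗ[ℝ] (b.supp → ℝ) := LinearMap.pi fun i => (LinearMap.proj (i : ι)).comp b.coord
  have hf : Function.Bijective f := by
    constructor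
    · intro x y h
      refine b.coord_injective (funext fun i => ?_)
      by_cases hi : i ∈ b.supp
      · exact congrFun h ⟨i, hi⟩
      · rw [b.coord_of_notMem _ _ hi, b.coord_of_notMem _ _ hi]
    · intro a
      refine ⟨∑ i, (if h : i ∈ b.supp then a ⟨i, h⟩ else 0) • w i, ?_⟩
      have := b.coord_sum (fun i => if h : i ∈ b.supp then a ⟨i, h⟩ else 0)
        (fun i hi => by simp [hi])
      exact funext fun i => (congrFun this i).trans (by simp)
  rw [(LinearEquiv.ofBijective f hf).finrank_eq]
  simp

variable {ι : Type*} [Fintype ι] {d : ℕ} {W : ι → Fin d → ℤ}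
  (b : SubfamilyBasis fun i => latticeEmbedding d (W i))

/-- The integer part of the `i`-th coordinate, rounded according to the direction `v`: it is
nonnegative exactly when `x + ε v` has positive `i`-th coordinate for small `ε > 0`. -/
def intPart (v x : Fin d → ℝ) (i : ι) : ℤ :=
  open Classical in if 0 < b.coord v i then ⌊b.coord x i⌋ else ⌈b.coord x i⌉ - 1

/-- The lattice points of the half-open fundamental parallelepiped. -/
def box (v : Fin d → ℝ) : Set (Fin d → ℤ) :=
  {p | ∀ i ∈ b.supp, b.intPart v (latticeEmbedding d p) i = 0}

theorem inHalfOpenCone_iff (v x : Fin d → ℝ) :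
    b.InHalfOpenCone v x ↔ ∀ i ∈ b.supp, 0 ≤ b.intPart v x i := by
  refine forall₂_congr fun i _ => ?_
  rw [intPart]
  split_ifs with h
  · rw [Int.floor_nonneg, le_iff_lt_or_eq]
    simp [h, eq_comm]
  · rw [sub_nonneg, Int.one_le_ceil_iff]
    simp [h]

theorem coord_lattice_add_sum (p : Fin d → ℤ) (n : ι → ℤ) (hn : ∀ i ∉ b.supp, n i = 0) (i : ι) :
    b.coord (latticeEmbedding d (p + ∑ k, n k • W k)) i
      = b.coord (latticeEmbedding d p) i + n i := by
  have : latticeEmbedding d (∑ k, n k • W k)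
      = ∑ k, (n k : ℝ) • latticeEmbedding d (W k) := by
    rw [map_sum]
    exact Finset.sum_congr rfl fun k _ => by rw [map_zsmul, Int.cast_smul_eq_zsmul]
  rw [map_add, map_add, this, b.coord_sum (fun k => (n k : ℝ)) (fun k hk => by simp [hn k hk])]
  rfl

theorem intPart_lattice_add_sum (v : Fin d → ℝ) (p : Fin d → ℤ) (n : ι → ℤ)
    (hn : ∀ i ∉ b.supp, n i = 0) (i : ι) :
    b.intPart v (latticeEmbedding d (p + ∑ k, n k • W k)) i
      = b.intPart v (latticeEmbedding d p) i + n i := by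
  simp only [intPart, b.coord_lattice_add_sum p n hn]
  split_ifs
  · exact Int.floor_add_intCast _ _
  · rw [Int.ceil_add_intCast]
    ring

theorem cost_lattice_add_sum (p : Fin d → ℤ) (n : ι → ℤ) (hn : ∀ i ∉ b.supp, n i = 0) :
    b.cost 1 (latticeEmbedding d (p + ∑ k, n k • W k))
      = b.cost 1 (latticeEmbedding d p) + ((∑ i ∈ b.supp, n i : ℤ) : ℝ) := by
  simp only [cost, b.coord_lattice_add_sum p n hn, Pi.one_apply, mul_one,
    Finset.sum_add_distrib, add_right_inj]
  rw [← Finset.sum_subset (Finset.subset_univ b.supp) (fun i _ hi => by simp [hn i hi])]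
  exact (Int.cast_sum _ _).symm

theorem coord_mem_Icc_of_mem_box {v : Fin d → ℝ} {p : Fin d → ℤ} (hp : p ∈ b.box v) (i : ι) :
    b.coord (latticeEmbedding d p) i ∈ Set.Icc (0 : ℝ) 1 := by
  by_cases hi : i ∈ b.supp
  · have := hp i hi
    rw [intPart] at this
    split_ifs at this
    · rw [Int.floor_eq_zero_iff] at this
      exact ⟨this.1, this.2.le⟩
    · rw [sub_eq_zero, Int.ceil_eq_iff] at this
      norm_num at this
      exact ⟨this.1.le, this.2⟩
  · simp [b.coord_of_notMem _ _ hi]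

theorem finite_box (v : Fin d → ℝ) : (b.box v).Finite := by
  have hcomp : IsCompact ((fun a : ι → ℝ => ∑ i, a i • latticeEmbedding d (W i)) ''
      Set.Icc (fun _ => 0) (fun _ => 1)) := isCompact_Icc.image (by fun_prop)
  refine (finite_latticePts hcomp.isBounded).subset fun p hp => ?_
  exact ⟨b.coord (latticeEmbedding d p), ⟨fun i => (b.coord_mem_Icc_of_mem_box hp i).1,
    fun i => (b.coord_mem_Icc_of_mem_box hp i).2⟩, b.sum_coord _⟩

theorem cost_mem_Icc_of_mem_box {v : Fin d → ℝ} {p : Fin d → ℤ} (hp : p ∈ b.box v) :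
    b.cost 1 (latticeEmbedding d p) ∈ Set.Icc (0 : ℝ) d := by
  have hsum : b.cost 1 (latticeEmbedding d p)
      = ∑ i ∈ b.supp, b.coord (latticeEmbedding d p) i := by
    simp only [cost, Pi.one_apply, mul_one]
    exact (Finset.sum_subset (Finset.subset_univ b.supp)
      fun i _ hi => b.coord_of_notMem _ _ hi).symm
  rw [hsum]
  refine ⟨Finset.sum_nonneg fun i _ => (b.coord_mem_Icc_of_mem_box hp i).1, ?_⟩
  calc _ ≤ ∑ i ∈ b.supp, (1 : ℝ) :=
        Finset.sum_le_sum fun i _ => (b.coord_mem_Icc_of_mem_box hp i).2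
    _ = d := by simp [b.card_supp]

/-- The height of a lattice point over the hyperplane through the origin. -/
def height (x : Fin d → ℤ) : ℤ := ⌊b.cost 1 (latticeEmbedding d x)⌋

/-- The functional equal to one on the basis takes integer values at lattice points. -/
def HasIntegralHeight : Prop := ∀ x : Fin d → ℤ, (b.height x : ℝ) = b.cost 1 (latticeEmbedding d x)

variable {b}

theorem HasIntegralHeight.height_add_sum (hb : b.HasIntegralHeight) (p : Fin d → ℤ) (n : ι → ℤ)
    (hn : ∀ i ∉ b.supp, n i = 0) :
    b.height (p + ∑ k, n k • W k) = b.height p + ∑ i ∈ b.supp, n i := by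
  have := b.cost_lattice_add_sum p n hn
  rw [← hb, ← hb] at this
  exact_mod_cast this

theorem HasIntegralHeight.ncard_halfOpenCone [DecidableEq ι] (hb : b.HasIntegralHeight)
    (v : Fin d → ℝ) (m : ℤ) :
    {x : Fin d → ℤ | b.InHalfOpenCone v (latticeEmbedding d x) ∧ b.height x ≤ m}.ncard
      = ∑ p ∈ (b.finite_box v).toFinset, (boundedFinsupps b.supp (m - b.height p)).card := by
  classical
  let f : (Σ _ : Fin d → ℤ, ι →₀ ℕ) → (Fin d → ℤ) :=
    fun q => q.1 + ∑ k, ((q.2 k : ℕ) : ℤ) • W k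
  have hoff : ∀ {n : ι →₀ ℕ}, n.support ⊆ b.supp → ∀ i ∉ b.supp, ((n i : ℕ) : ℤ) = 0 := by
    intro n hn i hi
    have : i ∉ n.support := fun h => hi (hn h)
    simpa using this
  have himage : {x : Fin d → ℤ | b.InHalfOpenCone v (latticeEmbedding d x) ∧ b.height x ≤ m}
      = ((((b.finite_box v).toFinset.sigma fun p =>
        boundedFinsupps b.supp (m - b.height p)).image f : Finset _) : Set (Fin d → ℤ)) := by
    ext x
    simp only [Set.mem_ofPred_eq, Finset.coe_image, Set.mem_image, Finset.mem_coe,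
      Finset.mem_sigma, Set.Finite.mem_toFinset, mem_boundedFinsupps, inHalfOpenCone_iff]
    constructor
    · rintro ⟨h1, h2⟩
      let n : ι →₀ ℕ := Finsupp.equivFunOnFinite.symm fun i =>
        if i ∈ b.supp then (b.intPart v (latticeEmbedding d x) i).toNat else 0
      have hns : n.support ⊆ b.supp := by
        intro i hi
        by_contra h
        simp [n, h] at hi
      have hn : ∀ i ∈ b.supp, ((n i : ℕ) : ℤ) = b.intPart v (latticeEmbedding d x) i := by
        intro i hi
        simp [n, hi, h1 i hi]
      let p := x + ∑ k, (-((n k : ℕ) : ℤ)) • W k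
      have hxp : f ⟨p, n⟩ = x := by simp [f, p]
      have hh := hb.height_add_sum p (fun k => ((n k : ℕ) : ℤ)) (hoff hns)
      change b.height (f ⟨p, n⟩) = _ at hh
      rw [hxp] at hh
      refine ⟨⟨p, n⟩, ⟨fun i hi => ?_, ?_, hns⟩, hxp⟩
      · rw [b.intPart_lattice_add_sum v x _ (fun i hi => by simp [hoff hns i hi]), hn i hi]
        ring
      · push_cast
        linarith
    · rintro ⟨⟨p, n⟩, ⟨hp, hle, hns⟩, rfl⟩
      refine ⟨fun i hi => ?_, ?_⟩
      · rw [b.intPart_lattice_add_sum v p _ (hoff hns), hp i hi]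
        simp
      · rw [hb.height_add_sum p _ (hoff hns)]
        push_cast at hle
        linarith
  rw [himage, Set.ncard_coe_finset, Finset.card_image_of_injOn, Finset.card_sigma]
  rintro ⟨p, n⟩ hpn ⟨q, k⟩ hqk h
  simp only [Finset.mem_coe, Finset.mem_sigma, Set.Finite.mem_toFinset,
    mem_boundedFinsupps] at hpn hqk
  obtain ⟨hp, -, hn⟩ := hpn
  obtain ⟨hq, -, hk⟩ := hqk
  have hnk : n = k := by
    ext i
    by_cases hi : i ∈ b.supp
    · have h1 := b.intPart_lattice_add_sum v p _ (hoff hn) i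
      have h2 := b.intPart_lattice_add_sum v q _ (hoff hk) i
      rw [hp i hi] at h1
      rw [hq i hi] at h2
      have h3 : p + ∑ k, ((n k : ℕ) : ℤ) • W k = q + ∑ j, ((k j : ℕ) : ℤ) • W j := h
      rw [h3, h2] at h1
      simpa using h1.symm
    · have h1 := hoff hn i hi
      have h2 := hoff hk i hi
      omega
  subst hnk
  have : p = q := by simpa [f] using h
  rw [this]

/-- Central reflection of the fundamental parallelepiped. -/
theorem HasIntegralHeight.sum_box_neg [DecidableEq ι] (hb : b.HasIntegralHeight)
    {v : Fin d → ℝ} (hv : ∀ i ∈ b.supp, b.coord v i ≠ 0) {M : Type*} [AddCommMonoid M]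
    (g : ℤ → M) :
    ∑ p ∈ (b.finite_box (-v)).toFinset, g (b.height p)
      = ∑ p ∈ (b.finite_box v).toFinset, g (d - b.height p) := by
  let e : ι → ℤ := fun i => if i ∈ b.supp then 1 else 0
  have he : ∀ i ∉ b.supp, e i = 0 := fun i hi => by simp [e, hi]
  let r : (Fin d → ℤ) → (Fin d → ℤ) := fun p => -p + ∑ k, e k • W k
  have hrr : ∀ p, r (r p) = p := fun p => by simp [r]
  have hr : ∀ {v : Fin d → ℝ}, (∀ i ∈ b.supp, b.coord v i ≠ 0) → ∀ p ∈ b.box v,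
      r p ∈ b.box (-v) := by
    intro v hv p hp i hi
    rw [b.intPart_lattice_add_sum _ _ _ he]
    have h := hp i hi
    have hvi := hv i hi
    simp only [intPart, map_neg, Pi.neg_apply, Left.neg_pos_iff, Int.ceil_neg,
      Int.floor_neg] at h ⊢
    simp only [e, hi, if_true]
    rcases hvi.lt_or_gt with h' | h'
    · rw [if_neg h'.not_gt] at h
      rw [if_pos h']
      linarith
    · rw [if_pos h'] at h
      rw [if_neg h'.not_gt]
      linarith
  have hheight : ∀ p, b.height (r p) = d - b.height p := by
    intro p
    have h1 : b.height (r p) = b.height (-p) + ∑ i ∈ b.supp, e i := hb.height_add_sum _ _ he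
    have h2 : ∑ i ∈ b.supp, e i = d := by
      rw [Finset.sum_congr rfl fun i hi => if_pos hi]
      simp [b.card_supp]
    have h3 : b.height (-p) = - b.height p := by
      have : (b.height (-p) : ℝ) = ((- b.height p : ℤ) : ℝ) := by
        push_cast
        rw [hb, hb]
        simp [cost]
      exact_mod_cast this
    rw [h1, h2, h3]
    ring
  refine Finset.sum_nbij' r r ?_ ?_ (fun p _ => hrr p) (fun p _ => hrr p) ?_
  · intro p hp
    rw [Set.Finite.mem_toFinset] at hp ⊢
    simpa using hr (v := -v) (fun i hi => by simpa using hv i hi) p hp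
  · intro p hp
    rw [Set.Finite.mem_toFinset] at hp ⊢
    exact hr hv p hp
  · intro p _
    rw [hheight]
    simp

end SubfamilyBasis

/-! ### Reflexive polytopes -/

theorem exists_weights_of_mem_convexHull_range {ι E : Type*} [Fintype ι] [AddCommGroup E]
    [Module ℝ E] {w : ι → E} {x : E} (hx : x ∈ convexHull ℝ (Set.range w)) :
    ∃ a : ι → ℝ, (∀ i, 0 ≤ a i) ∧ ∑ i, a i = 1 ∧ ∑ i, a i • w i = x := by
  classical
  have hconv : Convex ℝ ((Fintype.linearCombination ℝ w) '' stdSimplex ℝ ι) :=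
    (convex_stdSimplex ℝ ι).linear_image _
  have hsub : Set.range w ⊆ (Fintype.linearCombination ℝ w) '' stdSimplex ℝ ι := by
    rintro _ ⟨i, rfl⟩
    exact ⟨Pi.single i 1, single_mem_stdSimplex ℝ i, by simp⟩
  obtain ⟨a, ha, rfl⟩ := convexHull_min hsub hconv hx
  exact ⟨a, ha.1, ha.2, by simp [Fintype.linearCombination_apply]⟩

theorem exists_nonneg_combination_of_zero_mem_interior {ι E : Type*} [Fintype ι]
    [NormedAddCommGroup E] [NormedSpace ℝ E] {w : ι → E}
    (h0 : (0 : E) ∈ interior (convexHull ℝ (Set.range w))) (x : E) :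
    ∃ a : ι → ℝ, (∀ i, 0 ≤ a i) ∧ ∑ i, a i • w i = x := by
  have hcont : Filter.Tendsto (fun ε : ℝ => ε • x) (nhdsWithin 0 (Set.Ioi 0)) (nhds 0) := by
    have : ContinuousAt (fun ε : ℝ => ε • x) 0 := by fun_prop
    have h := this.tendsto.mono_left (nhdsWithin_le_nhds (s := Set.Ioi 0))
    simpa using h
  obtain ⟨ε, hε, hpos⟩ := ((hcont.eventually (mem_interior_iff_mem_nhds.1 h0)).and
    self_mem_nhdsWithin).exists
  have hpos : 0 < ε := hpos
  obtain ⟨a, ha, -, hax⟩ := exists_weights_of_mem_convexHull_range hε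
  refine ⟨fun i => ε⁻¹ * a i, fun i => mul_nonneg (inv_nonneg.2 hpos.le) (ha i), ?_⟩
  simp only [mul_smul, ← Finset.smul_sum, hax]
  rw [smul_smul, inv_mul_cancel₀ hpos.ne', one_smul]

theorem IsLatticePolytope.exists_fintype {d : ℕ} {P : Set (Fin d → ℝ)}
    (hP : IsLatticePolytope d P) : ∃ V : Finset (Fin d → ℤ),
      P = convexHull ℝ (Set.range fun v : V => latticeEmbedding d v) := by
  obtain ⟨V, rfl⟩ := hP
  refine ⟨V, ?_⟩
  rw [Set.image_eq_range]
  rfl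

namespace SubfamilyBasis

section

variable {ι E : Type*} [Fintype ι] [AddCommGroup E] [Module ℝ E] {w : ι → E}

theorem isLinearMap_cost (b : SubfamilyBasis w) (ω : ι → ℝ) : IsLinearMap ℝ (b.cost ω) where
  map_add x y := by simp [cost, add_mul, Finset.sum_add_distrib]
  map_smul c x := by simp [cost, Finset.mul_sum, mul_assoc]

theorem InHalfOpenCone.coord_nonneg {b : SubfamilyBasis w} {v x : E} (h : b.InHalfOpenCone v x)
    (i : ι) : 0 ≤ b.coord x i := by
  by_cases hi : i ∈ b.supp
  · rcases h i hi with h | h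
    · exact h.le
    · exact h.1.ge
  · exact (b.coord_of_notMem x i hi).ge

theorem IsFeasible.cost_le_one {b : SubfamilyBasis w} (hb : b.IsFeasible 1) {x : E}
    (hx : x ∈ convexHull ℝ (Set.range w)) : b.cost 1 x ≤ 1 := by
  refine convexHull_min (t := {x | b.cost 1 x ≤ 1}) ?_
    (convex_halfSpace_le (b.isLinearMap_cost 1) 1) hx
  rintro _ ⟨i, rfl⟩
  exact hb i

theorem IsFeasible.mem_smul_convexHull_iff {b : SubfamilyBasis w} (hb : b.IsFeasible 1)
    (h0 : (0 : E) ∈ convexHull ℝ (Set.range w)) {x : E} (hx : ∀ i, 0 ≤ b.coord x i)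
    {m : ℝ} (hm : 0 < m) : x ∈ m • convexHull ℝ (Set.range w) ↔ b.cost 1 x ≤ m := by
  constructor
  · rintro ⟨y, hy, rfl⟩
    have := hb.cost_le_one hy
    simp only [(b.isLinearMap_cost 1).map_smul, smul_eq_mul]
    nlinarith
  · intro h
    rw [Set.mem_smul_set_iff_inv_smul_mem₀ hm.ne']
    have hs : b.cost 1 x = ∑ i, b.coord x i := by simp [cost]
    rcases (Finset.sum_nonneg fun i _ => hx i : 0 ≤ ∑ i, b.coord x i).eq_or_lt with h1 | h1
    · have : x = 0 := by
        rw [← b.sum_coord x]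
        refine Finset.sum_eq_zero fun i _ => ?_
        rw [(Finset.sum_eq_zero_iff_of_nonneg fun i _ => hx i).1 h1.symm i (Finset.mem_univ _),
          zero_smul]
      simpa [this] using h0
    · have hmem : ∑ i, ((∑ i, b.coord x i)⁻¹ * b.coord x i) • w i
          ∈ convexHull ℝ (Set.range w) := by
        refine (convex_convexHull ℝ _).sum_mem
          (fun i _ => mul_nonneg (inv_nonneg.2 h1.le) (hx i)) ?_
          (fun i _ => subset_convexHull ℝ _ ⟨i, rfl⟩)
        rw [← Finset.mul_sum, inv_mul_cancel₀ h1.ne']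
      have heq : m⁻¹ • x = (m⁻¹ * ∑ i, b.coord x i) •
          ∑ i, ((∑ i, b.coord x i)⁻¹ * b.coord x i) • w i := by
        simp only [mul_smul, ← Finset.smul_sum, b.sum_coord]
        rw [smul_inv_smul₀ h1.ne']
      rw [heq]
      refine (convex_convexHull ℝ _).smul_mem_of_zero_mem h0 hmem ⟨by positivity, ?_⟩
      rw [inv_mul_le_iff₀ hm, mul_one, ← hs]
      exact h

end

/-- In a reflexive polytope the functionals cutting out the facets are integral. -/
theorem IsFeasible.hasIntegralHeight {ι : Type*} [Fintype ι] {d : ℕ} {W : ι → Fin d → ℤ}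
    {b : SubfamilyBasis fun i => latticeEmbedding d (W i)} (hb : b.IsFeasible 1)
    (hdual : IsLatticePolytope d
      (dualBody d (convexHull ℝ (Set.range fun i => latticeEmbedding d (W i))))) :
    b.HasIntegralHeight := by
  classical
  obtain ⟨U, hU⟩ := hdual.exists_fintype
  have hlin := b.isLinearMap_cost 1
  have hcost : ∀ x : Fin d → ℝ, ∑ k, (-b.cost 1 (Pi.single k 1)) * x k = - b.cost 1 x := by
    intro x
    have h1 : b.cost 1 x = ∑ k, x k * b.cost 1 (Pi.single k 1) := by
      have hsingle : ∀ k : Fin d, (Pi.single k 1 : Fin d → ℝ) = fun j => if k = j then 1 else 0 :=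
        fun k => funext fun j => by simp [Pi.single_apply, eq_comm]
      simpa [hsingle] using LinearMap.pi_apply_eq_sum_univ hlin.mk' x
    rw [h1, ← Finset.sum_neg_distrib]
    exact Finset.sum_congr rfl fun k _ => by ring
  have hmem : (fun k => -b.cost 1 (Pi.single k 1)) ∈
      dualBody d (convexHull ℝ (Set.range fun i => latticeEmbedding d (W i))) := by
    intro x hx
    rw [hcost]
    linarith [hb.cost_le_one hx]
  rw [hU] at hmem
  obtain ⟨μ, hμ0, hμ1, hμ⟩ := exists_weights_of_mem_convexHull_range hmem
  have hpair : ∀ x : Fin d → ℝ,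
      ∑ u, μ u * ∑ k, (latticeEmbedding d u) k * x k = - b.cost 1 x := by
    intro x
    rw [← hcost x]
    simp only [← congrFun hμ _, Finset.sum_apply, Pi.smul_apply, smul_eq_mul, Finset.sum_mul,
      Finset.mul_sum]
    rw [Finset.sum_comm]
    simp only [mul_assoc]
  obtain ⟨u, hu⟩ : ∃ u, 0 < μ u := by
    by_contra! h
    have : ∑ u, μ u ≤ 0 := Finset.sum_nonpos fun u _ => h u
    linarith
  have hge : ∀ (u : U) i, -1 ≤ ∑ k, (latticeEmbedding d u) k * latticeEmbedding d (W i) k := by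
    intro u i
    have : latticeEmbedding d u ∈
        dualBody d (convexHull ℝ (Set.range fun i => latticeEmbedding d (W i))) := by
      rw [hU]
      exact subset_convexHull ℝ _ ⟨u, rfl⟩
    exact this _ (subset_convexHull ℝ _ ⟨i, rfl⟩)
  have htight : ∀ i ∈ b.supp,
      ∑ k, (latticeEmbedding d u) k * latticeEmbedding d (W i) k = -1 := by
    intro i hi
    by_contra hne
    have hlt : -1 < ∑ k, (latticeEmbedding d u) k * latticeEmbedding d (W i) k :=
      lt_of_le_of_ne (hge u i) (Ne.symm hne)
    have h1 : ∑ u, μ u * (-1) < ∑ u, μ u * ∑ k, (latticeEmbedding d u) k *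
        latticeEmbedding d (W i) k :=
      Finset.sum_lt_sum (fun u _ => mul_le_mul_of_nonneg_left (hge u i) (hμ0 u))
        ⟨u, Finset.mem_univ _, mul_lt_mul_of_pos_left hlt hu⟩
    have h2 : b.cost 1 (latticeEmbedding d (W i)) = 1 := b.cost_apply_of_mem 1 hi
    rw [hpair, ← Finset.sum_mul, hμ1, h2] at h1
    linarith
  intro x
  have hx : b.cost 1 (latticeEmbedding d x) = ((-∑ k, (u : Fin d → ℤ) k * x k : ℤ) : ℝ) := by
    have h1 : ∑ k, (latticeEmbedding d u) k * latticeEmbedding d x k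
        = ∑ i, b.coord (latticeEmbedding d x) i *
          ∑ k, (latticeEmbedding d u) k * latticeEmbedding d (W i) k := by
      conv_lhs => rw [← b.sum_coord (latticeEmbedding d x)]
      simp only [Finset.sum_apply, Pi.smul_apply, smul_eq_mul, Finset.mul_sum]
      rw [Finset.sum_comm]
      exact Finset.sum_congr rfl fun i _ => Finset.sum_congr rfl fun k _ => by ring
    have h2 : ∑ i, b.coord (latticeEmbedding d x) i *
          ∑ k, (latticeEmbedding d u) k * latticeEmbedding d (W i) k
        = - b.cost 1 (latticeEmbedding d x) := by
      rw [cost, ← Finset.sum_neg_distrib]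
      refine Finset.sum_congr rfl fun i _ => ?_
      by_cases hi : i ∈ b.supp
      · rw [htight i hi]
        simp
      · simp [b.coord_of_notMem _ _ hi]
    rw [h2] at h1
    push_cast
    exact (neg_eq_iff_eq_neg.1 h1.symm)
  rw [height, hx, Int.floor_intCast]

end SubfamilyBasis

open SubfamilyBasis in
/-- The number of lattice points of a dilate of a reflexive polytope, expressed through the
half-open decomposition in direction `v`. -/
theorem ncard_latticePts_smul {ι : Type*} [Fintype ι] [DecidableEq ι] {d : ℕ}
    {W : ι → Fin d → ℤ} {T : Finset (SubfamilyBasis fun i => latticeEmbedding d (W i))}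
    (h0 : (0 : Fin d → ℝ) ∈ convexHull ℝ (Set.range fun i => latticeEmbedding d (W i)))
    (hT : ∀ b ∈ T, b.IsFeasible 1) (hint : ∀ b ∈ T, b.HasIntegralHeight) {v : Fin d → ℝ}
    (hv : ∀ x, ∃! b, b ∈ T ∧ b.InHalfOpenCone v x) {m : ℕ} (hm : 0 < m) :
    (latticePts d ((m : ℝ) • convexHull ℝ (Set.range fun i => latticeEmbedding d (W i)))).ncard
      = ∑ b ∈ T, ∑ p ∈ (b.finite_box v).toFinset,
          (boundedFinsupps b.supp (m - b.height p)).card := by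
  classical
  have hfin := finite_latticePts (((Set.finite_range fun i =>
    latticeEmbedding d (W i)).isCompact_convexHull ℝ).isBounded.smul₀ (m : ℝ))
  have hiff : ∀ b ∈ T, ∀ x : Fin d → ℤ, b.InHalfOpenCone v (latticeEmbedding d x) →
      (x ∈ latticePts d ((m : ℝ) • convexHull ℝ (Set.range fun i => latticeEmbedding d (W i)))
        ↔ b.height x ≤ m) := by
    intro b hb x hx
    have := (hT b hb).mem_smul_convexHull_iff h0 hx.coord_nonneg
      (m := m) (by exact_mod_cast hm)
    rw [← hint b hb x] at this
    exact this.trans (by norm_cast)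
  have hunion : hfin.toFinset
      = T.biUnion fun b => hfin.toFinset.filter fun x =>
          b.InHalfOpenCone v (latticeEmbedding d x) := by
    ext x
    simp only [Finset.mem_biUnion, Finset.mem_filter]
    constructor
    · intro hx
      obtain ⟨b, ⟨hb, hbx⟩, -⟩ := hv (latticeEmbedding d x)
      exact ⟨b, hb, hx, hbx⟩
    · rintro ⟨b, -, hx, -⟩
      exact hx
  rw [Set.ncard_eq_toFinset_card _ hfin, hunion, Finset.card_biUnion]
  · refine Finset.sum_congr rfl fun b hb => ?_
    rw [← (hint b hb).ncard_halfOpenCone v m, ← Set.ncard_coe_finset]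
    congr 1
    ext x
    simp only [Finset.coe_filter, Set.Finite.mem_toFinset, Set.mem_ofPred_eq]
    constructor
    · rintro ⟨h1, h2⟩
      exact ⟨h2, (hiff b hb x h2).1 h1⟩
    · rintro ⟨h1, h2⟩
      exact ⟨(hiff b hb x h1).2 h2, h1⟩
  · intro b hb c hc hbc
    rw [Function.onFun, Finset.disjoint_left]
    intro x hxb hxc
    rw [Finset.mem_filter] at hxb hxc
    exact hbc ((hv (latticeEmbedding d x)).unique ⟨hb, hxb.2⟩ ⟨hc, hxc.2⟩)

/-- Two polynomials agreeing at all positive integers are equal. -/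
theorem Polynomial.eq_of_eval_natCast_eq {p q : Polynomial ℚ}
    (h : ∀ m : ℕ, 0 < m → p.eval (m : ℚ) = q.eval (m : ℚ)) : p = q := by
  refine Polynomial.eq_of_infinite_eval_eq p q (Set.infinite_of_injective_forall_mem
    (f := fun m : ℕ => ((m + 1 : ℕ) : ℚ)) (fun a b hab => by simpa using hab) fun m => ?_)
  exact h (m + 1) m.succ_pos

/-- The polynomial `(t + 4 choose 4)`. -/
def simplexPolynomial : Polynomial ℚ :=
  Polynomial.C (1 / 24) * (X + 1) * (X + 2) * (X + 3) * (X + 4)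

theorem simplexPolynomial_eval (t : ℚ) :
    simplexPolynomial.eval t = (t + 1) * (t + 2) * (t + 3) * (t + 4) / 24 := by
  simp [simplexPolynomial]
  ring

theorem natDegree_simplexPolynomial_le : simplexPolynomial.natDegree ≤ 4 := by
  rw [simplexPolynomial]
  compute_degree

open SubfamilyBasis in
/-- The Ehrhart polynomial of a four-dimensional reflexive polytope has degree at most four and
is symmetric about `-1/2`. -/
theorem IsEhrhart.natDegree_le_and_symm {P : Set (Fin 4 → ℝ)} {L : Polynomial ℚ}
    (hP : IsLatticePolytope 4 P) (href : IsReflexive 4 P) (hL : IsEhrhart 4 P L) :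
    L.natDegree ≤ 4 ∧ ∀ t, L.eval (-1 - t) = L.eval t := by
  classical
  obtain ⟨V, rfl⟩ := hP.exists_fintype
  obtain ⟨T, hT, hdec⟩ := exists_halfOpen_decomposition
    (exists_nonneg_combination_of_zero_mem_interior href.1)
  have hint : ∀ b ∈ T, b.HasIntegralHeight := fun b hb => (hT b hb).hasIntegralHeight href.2
  have hcard : ∀ b ∈ T, b.supp.card = 4 := fun b _ => by simp [b.card_supp]
  have key : ∀ v, SubfamilyBasis.IsGenericPoint (fun v : V => latticeEmbedding 4 v) v →
      L = ∑ b ∈ T, ∑ p ∈ (b.finite_box v).toFinset,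
        simplexPolynomial.comp (X - Polynomial.C (b.height p : ℚ)) := by
    intro v hv
    refine Polynomial.eq_of_eval_natCast_eq fun m hm => ?_
    rw [hL m, ncard_latticePts_smul (interior_subset href.1) hT hint (hdec v hv) hm]
    push_cast
    simp only [Polynomial.eval_finsetSum, Polynomial.eval_comp, Polynomial.eval_sub,
      Polynomial.eval_X, Polynomial.eval_C]
    refine Finset.sum_congr rfl fun b hb => Finset.sum_congr rfl fun p hp => ?_
    rw [Set.Finite.mem_toFinset] at hp
    have hle : b.height p ≤ 4 := by
      have h1 := (b.cost_mem_Icc_of_mem_box hp).2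
      rw [← hint b hb p] at h1
      exact_mod_cast h1
    rw [card_boundedFinsupps (hcard b hb) (by omega), simplexPolynomial_eval]
    push_cast
    ring
  obtain ⟨v, hv⟩ := exists_isGenericPoint fun v : V => latticeEmbedding 4 v
  constructor
  · rw [key v hv]
    refine Polynomial.natDegree_sum_le_of_forall_le _ _ fun b _ =>
      Polynomial.natDegree_sum_le_of_forall_le _ _ fun p _ => ?_
    rw [Polynomial.natDegree_comp, Polynomial.natDegree_X_sub_C, mul_one]
    exact natDegree_simplexPolynomial_le
  · intro t
    conv_lhs => rw [key (-v) hv.neg]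
    conv_rhs => rw [key v hv]
    simp only [Polynomial.eval_finsetSum, Polynomial.eval_comp, Polynomial.eval_sub,
      Polynomial.eval_X, Polynomial.eval_C]
    refine Finset.sum_congr rfl fun b hb => ?_
    rw [(hint b hb).sum_box_neg (hv b)
      fun k => simplexPolynomial.eval (-1 - t - (k : ℚ))]
    refine Finset.sum_congr rfl fun p _ => ?_
    rw [simplexPolynomial_eval, simplexPolynomial_eval]
    push_cast
    ring

/-! ### The leading coefficient -/

theorem tendsto_ncard_latticePts_div_pow {d : ℕ} {P : Set (Fin d → ℝ)}
    (hbdd : Bornology.IsBounded P) (hmeas : MeasurableSet P) (hconv : Convex ℝ P) :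
    Filter.Tendsto (fun m : ℕ => ((latticePts d ((m : ℝ) • P)).ncard : ℝ) / (m : ℝ) ^ d)
      Filter.atTop (nhds (vol d P)) := by
  have h := tendsto_card_div_pow_atTop_volume P hbdd hmeas (hconv.addHaar_frontier volume)
  rw [Fintype.card_fin] at h
  refine h.congr' ?_
  filter_upwards [Filter.eventually_gt_atTop 0] with m hm
  have hm' : (m : ℝ) ≠ 0 := by exact_mod_cast hm.ne'
  congr 2
  have himage : P ∩ (m : ℝ)⁻¹ • (Submodule.span ℤ (Set.range (Pi.basisFun ℝ (Fin d))) :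
      Set (Fin d → ℝ)) = (fun x => (m : ℝ)⁻¹ • latticeEmbedding d x) ''
        latticePts d ((m : ℝ) • P) := by
    ext y
    simp only [Set.mem_inter_iff, Set.mem_image]
    rw [Set.mem_smul_set_iff_inv_smul_mem₀ (inv_ne_zero hm'), inv_inv, SetLike.mem_coe,
      Module.Basis.mem_span_iff_repr_mem]
    constructor
    · rintro ⟨hy, hint⟩
      choose x hx using hint
      have hxy : latticeEmbedding d x = (m : ℝ) • y :=
        funext fun i => by change (x i : ℝ) = _; simpa using hx i
      refine ⟨x, ?_, by rw [hxy, inv_smul_smul₀ hm']⟩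
      change latticeEmbedding d x ∈ (m : ℝ) • P
      rw [hxy]
      exact Set.smul_mem_smul_set hy
    · rintro ⟨x, hx, rfl⟩
      refine ⟨(Set.mem_smul_set_iff_inv_smul_mem₀ hm' _ _).1 hx, fun i => ⟨x i, ?_⟩⟩
      simp [hm', latticeEmbedding]
  change Set.ncard _ = _
  rw [himage]
  exact Set.ncard_image_of_injective _
    ((smul_right_injective _ (inv_ne_zero hm')).comp (latticeEmbedding_injective d))

/-- The leading coefficient of the Ehrhart polynomial is the volume. -/
theorem IsEhrhart.coeff_eq_vol {P : Set (Fin 4 → ℝ)} {L : Polynomial ℚ}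
    (hP : IsLatticePolytope 4 P) (hL : IsEhrhart 4 P L) (hdeg : L.natDegree ≤ 4) :
    ((L.coeff 4 : ℚ) : ℝ) = vol 4 P := by
  obtain ⟨V, rfl⟩ := hP.exists_fintype
  have hcomp := (Set.finite_range fun v : V => latticeEmbedding 4 v).isCompact_convexHull ℝ
  have h1 := tendsto_ncard_latticePts_div_pow hcomp.isBounded hcomp.isClosed.measurableSet
    (convex_convexHull ℝ _)
  refine tendsto_nhds_unique ?_ h1
  have hinv : Filter.Tendsto (fun m : ℕ => ((m : ℝ))⁻¹) Filter.atTop (nhds 0) :=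
    tendsto_inv_atTop_nhds_zero_nat
  have h2 : Filter.Tendsto (fun m : ℕ => ((L.coeff 4 : ℚ) : ℝ) + L.coeff 3 * ((m : ℝ))⁻¹ +
      L.coeff 2 * ((m : ℝ))⁻¹ ^ 2 + L.coeff 1 * ((m : ℝ))⁻¹ ^ 3 + L.coeff 0 * ((m : ℝ))⁻¹ ^ 4)
      Filter.atTop (nhds (((L.coeff 4 : ℚ) : ℝ) + L.coeff 3 * 0 +
      L.coeff 2 * 0 ^ 2 + L.coeff 1 * 0 ^ 3 + L.coeff 0 * 0 ^ 4)) :=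
    ((((tendsto_const_nhds).add (hinv.const_mul _)).add ((hinv.pow 2).const_mul _)).add
      ((hinv.pow 3).const_mul _)).add ((hinv.pow 4).const_mul _)
  simp only [mul_zero, add_zero, ne_eq, OfNat.ofNat_ne_zero, not_false_eq_true, zero_pow] at h2
  refine h2.congr' ?_
  filter_upwards [Filter.eventually_gt_atTop 0] with m hm
  have hm' : (m : ℝ) ≠ 0 := by exact_mod_cast hm.ne'
  have h3 : ((latticePts 4 ((m : ℝ) • convexHull ℝ
      (Set.range fun v : V => latticeEmbedding 4 v))).ncard : ℝ) = ((L.eval (m : ℚ) : ℚ) : ℝ) := by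
    rw [hL m]
    norm_cast
  rw [h3, Polynomial.eval_eq_sum_range' (Nat.lt_succ_of_le hdeg)]
  simp only [Finset.sum_range_succ, Finset.sum_range_zero]
  push_cast
  field_simp
  ring

theorem vol_pos {d : ℕ} {P : Set (Fin d → ℝ)} (hP : IsLatticePolytope d P)
    (h0 : (0 : Fin d → ℝ) ∈ interior P) : 0 < vol d P := by
  obtain ⟨V, rfl⟩ := hP.exists_fintype
  have hcomp := (Set.finite_range fun v : V => latticeEmbedding d v).isCompact_convexHull ℝ
  exact ENNReal.toReal_pos (Measure.measure_pos_of_nonempty_interior volume ⟨0, h0⟩).ne'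
    hcomp.measure_lt_top.ne

theorem IsEhrhart.eval_zero {d : ℕ} {P : Set (Fin d → ℝ)} {L : Polynomial ℚ}
    (hne : P.Nonempty) (hL : IsEhrhart d P L) : L.eval 0 = 1 := by
  have h := hL 0
  have : latticePts d (((0 : ℕ) : ℝ) • P) = {0} := by
    ext x
    rw [Nat.cast_zero, Set.zero_smul_set hne]
    exact ⟨fun hx => latticeEmbedding_injective d (hx.trans (map_zero _).symm),
      fun hx => by rw [Set.mem_singleton_iff.1 hx]; exact map_zero (latticeEmbedding d)⟩
  rw [this] at h
  simpa using h

/-! ### Biquadratic polynomials with all roots on a vertical line -/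

/-- All complex roots of `a w⁴ + β w² + γ` are purely imaginary exactly when the quadratic
`a s² + β s + γ` has two real nonpositive roots. -/
theorem biquadratic_roots_re_eq_zero_iff {a β γ : ℝ} (ha : 0 < a) :
    (∀ w : ℂ, (a : ℂ) * w ^ 4 + β * w ^ 2 + γ = 0 → w.re = 0) ↔
      0 ≤ β ∧ 0 ≤ γ ∧ 0 ≤ β ^ 2 - 4 * a * γ := by
  have ha' : (a : ℂ) ≠ 0 := by exact_mod_cast ha.ne'
  constructor
  · intro h
    have hsq : ∀ s : ℂ, (a : ℂ) * s ^ 2 + β * s + γ = 0 → ∃ p : ℝ, 0 ≤ p ∧ s = -(p : ℂ) := by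
      intro s hs
      obtain ⟨w, rfl⟩ := IsAlgClosed.exists_pow_nat_eq s (n := 2) (by norm_num)
      have hw := h w (by rw [← hs]; ring)
      refine ⟨w.im ^ 2, sq_nonneg _, ?_⟩
      have : w = w.im * Complex.I := by
        apply Complex.ext <;> simp [hw]
      conv_lhs => rw [this, mul_pow, Complex.I_sq]
      push_cast
      ring
    obtain ⟨δ, hδ⟩ := IsAlgClosed.exists_pow_nat_eq ((β : ℂ) ^ 2 - 4 * a * γ) (n := 2)
      (by norm_num)
    obtain ⟨p, hp, hp'⟩ := hsq ((-β + δ) / (2 * a)) (by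
      field_simp
      linear_combination hδ)
    obtain ⟨q, hq, hq'⟩ := hsq ((-β - δ) / (2 * a)) (by
      field_simp
      linear_combination hδ)
    rw [div_eq_iff (by simpa using ha')] at hp' hq'
    have hβ : β = a * (p + q) := by
      have : (β : ℂ) = a * (p + q) := by linear_combination -(hp' + hq') / 2
      exact_mod_cast this
    have hδ' : δ = ((a * (q - p) : ℝ) : ℂ) := by
      push_cast
      linear_combination (hp' - hq') / 2
    have hdisc : β ^ 2 - 4 * a * γ = (a * (q - p)) ^ 2 := by
      rw [hδ'] at hδ
      exact_mod_cast hδ.symm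
    have hγ : γ = a * (p * q) := by
      rw [hβ] at hdisc
      have : (4 * a) * (γ - a * (p * q)) = 0 := by linear_combination -hdisc
      have := (mul_eq_zero.1 this).resolve_left (by positivity)
      linarith
    exact ⟨by rw [hβ]; positivity, by rw [hγ]; positivity, by rw [hdisc]; positivity⟩
  · rintro ⟨hβ, hγ, hdisc⟩ w hw
    set δ := Real.sqrt (β ^ 2 - 4 * a * γ) with hδ
    have hδ2 : δ ^ 2 = β ^ 2 - 4 * a * γ := Real.sq_sqrt hdisc
    have hδβ : δ ≤ β := by
      rw [hδ, Real.sqrt_le_left hβ]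
      nlinarith [mul_nonneg ha.le hγ]
    have hδ0 : 0 ≤ δ := Real.sqrt_nonneg _
    have hfac : (2 * a * w ^ 2 + β - δ) * (2 * a * w ^ 2 + β + δ) = 0 := by
      have : (δ : ℂ) ^ 2 = β ^ 2 - 4 * a * γ := by exact_mod_cast hδ2
      linear_combination 4 * a * hw - this
    have key : ∀ r : ℝ, r ≤ 0 → (2 * a : ℂ) * w ^ 2 = r → w.re = 0 := by
      intro r hr h
      have hre := congrArg Complex.re h
      have him := congrArg Complex.im h
      simp [pow_two] at hre him
      rcases him with h1 | h1
      · exact absurd h1 ha.ne'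
      · by_contra hne
        have him0 : w.im = 0 := by
          have : w.re * w.im = 0 := by linarith
          exact (mul_eq_zero.1 this).resolve_left hne
        rw [him0] at hre
        have : 0 < a * (w.re * w.re) := mul_pos ha (mul_self_pos.2 hne)
        nlinarith
    rcases mul_eq_zero.1 hfac with h | h
    · exact key (δ - β) (by linarith) (by push_cast; linear_combination h)
    · exact key (-δ - β) (by linarith) (by push_cast; linear_combination h)

theorem statement7 (P : Set (Fin 4 → ℝ)) (L : Polynomial ℚ)
    (hP : IsLatticePolytope 4 P) (hdim : IsFullDim 4 P) (href : IsReflexive 4 P)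
    (hL : IsEhrhart 4 P L) :
    IsCL L ↔
      (vol 4 P = 16 ∧ (latticePts 4 P).ncard = 81) ∨
      (5 * vol 4 P < ((latticePts 4 P).ncard : ℝ) - 1 ∧
        2 * ((latticePts 4 P).ncard : ℝ) ≤ 9 * (vol 4 P + 2) ∧
        (((latticePts 4 P).ncard : ℝ) - 1 - 4 * vol 4 P) ^ 2 ≥ 16 * vol 4 P) := by
  obtain ⟨hdeg, hsymm⟩ := hL.natDegree_le_and_symm hP href
  have hvol := hL.coeff_eq_vol hP hdeg
  have hpos := vol_pos hP href.1
  have h0 : L.eval 0 = 1 := hL.eval_zero ⟨0, interior_subset href.1⟩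
  have h1 : L.eval 1 = ((latticePts 4 P).ncard : ℚ) := by simpa using hL 1
  have hsymm0 := hsymm 0
  have hsymm1 := hsymm 1
  rw [h0] at hsymm0
  rw [h1] at hsymm1
  simp only [Polynomial.eval_eq_sum_range' (Nat.lt_succ_of_le hdeg), Finset.sum_range_succ,
    Finset.sum_range_zero] at h0 h1 hsymm0 hsymm1
  norm_num at h0 h1 hsymm0 hsymm1
  set a := vol 4 P with ha
  set n : ℝ := ((latticePts 4 P).ncard : ℝ) with hn
  have hnq : (((latticePts 4 P).ncard : ℚ) : ℝ) = n := by simp [hn]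
  have hc0 : ((L.coeff 0 : ℚ) : ℝ) = 1 := by exact_mod_cast h0
  have hc3 : ((L.coeff 3 : ℚ) : ℝ) = 2 * a := by
    rw [← hvol]
    have : L.coeff 3 = 2 * L.coeff 4 := by linarith
    exact_mod_cast this
  have hc2 : ((L.coeff 2 : ℚ) : ℝ) = (n - 1) / 2 - a := by
    rw [← hvol, ← hnq]
    have : L.coeff 2 = (((latticePts 4 P).ncard : ℚ) - 1) / 2 - L.coeff 4 := by linarith
    rw [this]
    push_cast
    ring
  have hc1 : ((L.coeff 1 : ℚ) : ℝ) = (n - 1) / 2 - 2 * a := by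
    rw [← hvol, ← hnq]
    have : L.coeff 1 = (((latticePts 4 P).ncard : ℚ) - 1) / 2 - 2 * L.coeff 4 := by linarith
    rw [this]
    push_cast
    ring
  have hL0 : L ≠ 0 := by
    rintro rfl
    simp at h0
  have hroot : ∀ z : ℂ, z ∈ cRoots L ↔ (a : ℂ) * (z + 1 / 2) ^ 4
      + ((n - 1 - 5 * a) / 2 : ℝ) * (z + 1 / 2) ^ 2 + ((18 + 9 * a - 2 * n) / 16 : ℝ) = 0 := by
    intro z
    have hcast : ∀ i, (algebraMap ℚ ℂ) (L.coeff i) = (((L.coeff i : ℚ) : ℝ) : ℂ) :=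
      fun i => by simp
    rw [cRoots, Polynomial.mem_roots (by simpa [Polynomial.map_eq_zero] using hL0),
      Polynomial.IsRoot.def, Polynomial.eval_map, Polynomial.eval₂_eq_sum_range'
      _ (Nat.lt_succ_of_le hdeg)]
    simp only [Finset.sum_range_succ, Finset.sum_range_zero, hcast, hc0, hc1, hc2, hc3, hvol]
    refine Eq.congr ?_ rfl
    push_cast
    ring
  have hCL : IsCL L ↔ ∀ w : ℂ, (a : ℂ) * w ^ 4 + ((n - 1 - 5 * a) / 2 : ℝ) * w ^ 2
      + ((18 + 9 * a - 2 * n) / 16 : ℝ) = 0 → w.re = 0 := by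
    constructor
    · intro h w hw
      have := h (w - 1 / 2) ((hroot _).2 (by simpa using hw))
      simp at this
      linarith
    · intro h z hz
      have := h _ ((hroot z).1 hz)
      simp at this
      linarith
  rw [hCL, biquadratic_roots_re_eq_zero_iff hpos]
  have hncard : (latticePts 4 P).ncard = 81 ↔ n = 81 := by
    rw [hn]
    norm_cast
  rw [hncard]
  have hdisc : ((n - 1 - 5 * a) / 2) ^ 2 - 4 * a * ((18 + 9 * a - 2 * n) / 16)
      = ((n - 1 - 4 * a) ^ 2 - 16 * a) / 4 := by ring
  constructor
  · rintro ⟨hβ, hγ, hδ⟩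
    rcases hβ.eq_or_lt with h | h
    · left
      have hγ0 : (18 + 9 * a - 2 * n) / 16 = 0 := by
        rw [← h] at hδ
        have : a * ((18 + 9 * a - 2 * n) / 16) ≤ 0 := by linarith
        exact le_antisymm (nonpos_of_mul_nonpos_right this hpos) hγ
      constructor <;> linarith
    · right
      rw [hdisc] at hδ
      refine ⟨by linarith, by linarith, by linarith⟩
  · rintro (⟨h1, h2⟩ | ⟨h1, h2, h3⟩)
    · rw [h1, h2]
      norm_num
    · rw [hdisc]
      refine ⟨by linarith, by linarith, by linarith⟩
end
end

section
/- Let P ⊂ ℝ⁴ be a 4-dimensional real reflexive polytope (i.e. reflexive and every complex root of L_P has imaginary part 0). Then vol(P) ≥ 3. -/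
open Pointwise MeasureTheory Polynomial

noncomputable section

/-- The bases of `E` consisting of vectors of a finite set `V`. -/
def Frame {E : Type*} [AddCommGroup E] [Module ℝ E] (V : Finset E) : Type _ :=
  {T : Finset E // T ⊆ V ∧ LinearIndepOn ℝ id (T : Set E) ∧
    Submodule.span ℝ (T : Set E) = ⊤}

namespace Frame

open scoped Classical in
instance {E : Type*} [AddCommGroup E] [Module ℝ E] (V : Finset E) : Finite (Frame V) :=
  Finite.of_injective
    (fun T : Frame V => (⟨T.1, Finset.mem_powerset.2 T.2.1⟩ : V.powerset))
    (fun _ _ h => Subtype.ext (congrArg (fun x => x.1) h))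

variable {E : Type*} [AddCommGroup E] [Module ℝ E] {V : Finset E}

/-- A frame as a basis indexed by its own elements. -/
def basis (T : Frame V) : Module.Basis T.1 ℝ E :=
  Module.Basis.mk (v := fun t : T.1 => (t : E)) T.2.2.1
    (by
      have h : Set.range (fun t : T.1 => (t : E)) = (T.1 : Set E) := Subtype.range_coe
      rw [h, T.2.2.2])

@[simp] lemma basis_apply (T : Frame V) (t : T.1) : T.basis t = t :=
  Module.Basis.mk_apply _ _ t

lemma mem_vertices (T : Frame V) (t : T.1) : (t : E) ∈ V := T.2.1 t.2

/-- A vector is generic when it lies on no hyperplane spanned by elements of `V`. -/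
def IsGeneric (V : Finset E) (y : E) : Prop :=
  ∀ (T : Frame V) (t : T.1), T.basis.repr y t ≠ 0

lemma exists_isGeneric (V : Finset E) : ∃ q : E, IsGeneric V q := by
  obtain ⟨q, hq⟩ := Module.Dual.exists_forall_ne_zero_of_forall_exists (K := ℝ) (M := E)
    (ι := Σ T : Frame V, T.1) (fun p => p.1.basis.coord p.2)
    (fun p => ⟨p.1.basis p.2, by simp [-basis_apply]⟩)
  exact ⟨q, fun T t => hq ⟨T, t⟩⟩

/-- The linear extension to `E` of a height function restricted to a frame. -/
def height (T : Frame V) (ω : E → ℝ) : E →ₗ[ℝ] ℝ :=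
  T.basis.constr ℝ (fun t => ω t)

lemma height_mem (T : Frame V) (ω : E → ℝ) (t : T.1) : T.height ω t = ω t := by
  have := T.basis.constr_basis ℝ (fun t => ω t) t
  rwa [basis_apply] at this

lemma apply_eq_sum (T : Frame V) (f : E →ₗ[ℝ] ℝ) (y : E) :
    f y = ∑ t : T.1, T.basis.repr y t * f t := by
  conv_lhs => rw [← T.basis.sum_repr y]
  simp

lemma exists_heights (V : Finset E) :
    ∃ ω : E → ℝ, ∀ (T : Frame V), ∀ s ∈ V, s ∉ T.1 → T.height ω s ≠ ω s := by
  classical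
  obtain ⟨ω, hω⟩ := Module.Dual.exists_forall_ne_zero_of_forall_exists (K := ℝ) (M := E → ℝ)
    (ι := Σ T : Frame V, {s : V // (s : E) ∉ T.1})
    (fun p => ∑ t : p.1.1, p.1.basis.repr p.2.1 t • LinearMap.proj (t : E) -
      LinearMap.proj (p.2.1 : E))
    (fun p => ⟨Pi.single (p.2.1 : E) 1, by
      have h : ∀ t : p.1.1, (Pi.single (p.2.1 : E) (1 : ℝ) : E → ℝ) t = 0 := fun t =>
        Pi.single_eq_of_ne (fun h : (t : E) = p.2.1 => p.2.2 (h ▸ t.2)) _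
      simp [h]⟩)
  refine ⟨ω, fun T s hs hsT h => hω ⟨T, ⟨s, hs⟩, hsT⟩ ?_⟩
  rw [apply_eq_sum T] at h
  simp only [height_mem] at h
  simpa [sub_eq_zero] using h

/-- The frames of the regular subdivision, with heights `ω`, of the complex of faces
`{v ∈ V | u v = 1}`, `u ∈ U`. -/
def triangulation (V : Finset E) (U : Set (E →ₗ[ℝ] ℝ)) (ω : E → ℝ) : Set (Frame V) :=
  {T | ∃ u ∈ U, (∀ t ∈ T.1, u t = 1) ∧ ∀ s ∈ V, u s = 1 → s ∉ T.1 → T.height ω s < ω s}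

lemma triangulation_subsingleton {U : Set (E →ₗ[ℝ] ℝ)} {ω : E → ℝ}
    (hU : ∀ u ∈ U, ∀ v ∈ V, u v ≤ 1) {T T' : Frame V} (hT : T ∈ triangulation V U ω)
    (hT' : T' ∈ triangulation V U ω) {y : E} (hy : ∀ t, 0 < T.basis.repr y t)
    (hy' : ∀ t, 0 < T'.basis.repr y t) : T = T' := by
  -- optimality of one frame against another one carrying the same vector
  have key : ∀ T T' : Frame V, T ∈ triangulation V U ω → T' ∈ triangulation V U ω →
      (∀ t, 0 < T.basis.repr y t) → (∀ t, 0 < T'.basis.repr y t) →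
      T.height ω y ≤ T'.height ω y ∧ (T.height ω y = T'.height ω y → T'.1 ⊆ T.1) := by
    rintro T T' ⟨u, hu, hu1, hus⟩ ⟨u', hu', hu1', -⟩ hy hy'
    have hle : u' y ≤ u y := by
      rw [apply_eq_sum T u', apply_eq_sum T u]
      refine Finset.sum_le_sum fun t _ => mul_le_mul_of_nonneg_left ?_ (hy t).le
      rw [hu1 t t.2]
      exact hU u' hu' t (T.mem_vertices t)
    have hface : ∀ t : T'.1, u t = 1 := by
      by_contra! hne
      obtain ⟨t₀, ht₀⟩ := hne
      refine hle.not_gt ?_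
      rw [apply_eq_sum T' u', apply_eq_sum T' u]
      refine Finset.sum_lt_sum (fun t _ => mul_le_mul_of_nonneg_left ?_ (hy' t).le)
        ⟨t₀, Finset.mem_univ _, mul_lt_mul_of_pos_left ?_ (hy' t₀)⟩
      · rw [hu1' t t.2]
        exact hU u hu t (T'.mem_vertices t)
      · rw [hu1' t₀ t₀.2]
        exact lt_of_le_of_ne (hU u hu t₀ (T'.mem_vertices t₀)) ht₀
    have hpt : ∀ t : T'.1, T.height ω t ≤ ω t := fun t => by
      by_cases ht : (t : E) ∈ T.1
      · exact (height_mem T ω ⟨t, ht⟩).le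
      · exact (hus t (T'.mem_vertices t) (hface t) ht).le
    rw [apply_eq_sum T' (T.height ω), apply_eq_sum T' (T'.height ω)]
    simp only [height_mem]
    refine ⟨Finset.sum_le_sum fun t _ => mul_le_mul_of_nonneg_left (hpt t) (hy' t).le, ?_⟩
    intro heq t ht
    by_contra htT
    refine heq.not_lt (Finset.sum_lt_sum
      (fun t _ => mul_le_mul_of_nonneg_left (hpt t) (hy' t).le)
      ⟨⟨t, ht⟩, Finset.mem_univ _, mul_lt_mul_of_pos_left ?_ (hy' ⟨t, ht⟩)⟩)
    exact hus t (T'.2.1 ht) (hface ⟨t, ht⟩) htT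
  obtain ⟨h₁, h₂⟩ := key T T' hT hT' hy hy'
  obtain ⟨h₃, h₄⟩ := key T' T hT' hT hy' hy
  have h := le_antisymm h₁ h₃
  exact Subtype.ext (Finset.Subset.antisymm (h₄ h.symm) (h₂ h))

/-- A minimizer of a linear objective over a polyhedron in standard form has nonnegative
derivative along feasible directions. -/
lemma objective_nonneg_of_isMinOn {κ : Type*} [Fintype κ] {v : κ → E} {y : E} {ω Λ dir : κ → ℝ}
    (hΛ : ∀ i, 0 ≤ Λ i) (hy : ∑ i, Λ i • v i = y)
    (hmin : ∀ Λ' : κ → ℝ, (∀ i, 0 ≤ Λ' i) → ∑ i, Λ' i • v i = y →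
      ∑ i, Λ i * ω i ≤ ∑ i, Λ' i * ω i)
    (hdir : ∑ i, dir i • v i = 0) (hfeas : ∀ i, 0 < Λ i ∨ 0 ≤ dir i) :
    0 ≤ ∑ i, dir i * ω i := by
  have hev : ∀ᶠ δ : ℝ in nhdsWithin 0 (Set.Ioi 0), ∀ i, 0 ≤ Λ i + δ * dir i := by
    rw [Filter.eventually_all]
    intro i
    rcases hfeas i with h | h
    · have hc : Continuous fun δ : ℝ => Λ i + δ * dir i := by fun_prop
      have ht : Filter.Tendsto (fun δ : ℝ => Λ i + δ * dir i) (nhds 0) (nhds (Λ i)) := by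
        simpa using hc.tendsto 0
      exact ((ht.eventually (lt_mem_nhds h)).filter_mono nhdsWithin_le_nhds).mono fun _ h => h.le
    · filter_upwards [self_mem_nhdsWithin] with δ hδ
      exact add_nonneg (hΛ i) (mul_nonneg (le_of_lt hδ) h)
  obtain ⟨δ, hδ, hδ0⟩ := (hev.and self_mem_nhdsWithin).exists
  have h := hmin (fun i => Λ i + δ * dir i) hδ (by
    simp only [add_smul, Finset.sum_add_distrib, mul_smul, ← Finset.smul_sum, hdir, hy,
      smul_zero, add_zero])
  simp only [add_mul, Finset.sum_add_distrib, mul_assoc, ← Finset.mul_sum] at h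
  exact nonneg_of_mul_nonneg_right (by linarith) (Set.mem_Ioi.1 hδ0)

/-- A generic vector in the span of `S ⊆ V` lies in the span of a frame contained in `S`. -/
lemma exists_frame_subset (hV : Submodule.span ℝ (V : Set E) = ⊤) {S : Set E}
    (hS : S ⊆ V) {y : E} (hy : IsGeneric V y) (hyS : y ∈ Submodule.span ℝ S) :
    ∃ T : Frame V, (T.1 : Set E) ⊆ S := by
  obtain ⟨B₀, hB₀S, -, hSB₀, hB₀⟩ :=
    exists_linearIndepOn_id_extension (linearIndepOn_empty ℝ (id : E → E)) (Set.empty_subset S)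
  obtain ⟨B, hBV, hB₀B, hVB, hB⟩ := exists_linearIndepOn_id_extension hB₀ (hB₀S.trans hS)
  have hfin : B.Finite := V.finite_toSet.subset hBV
  let T : Frame V := ⟨hfin.toFinset, by simpa using hBV, by simpa using hB, by
    rw [Set.Finite.coe_toFinset, eq_top_iff, ← hV]
    exact Submodule.span_le.2 hVB⟩
  have hT : ∀ t, t ∈ T.1 ↔ t ∈ B := fun t => hfin.mem_toFinset
  refine ⟨T, fun t ht => ?_⟩
  by_contra htS
  refine hy T ⟨t, ht⟩ ?_
  have hle : Submodule.span ℝ B₀ ≤ LinearMap.ker (T.basis.coord ⟨t, ht⟩) := by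
    refine Submodule.span_le.2 fun b hb => ?_
    have hbT : b ∈ T.1 := (hT b).2 (hB₀B hb)
    have hbt : (⟨b, hbT⟩ : T.1) ≠ ⟨t, ht⟩ := fun h => by
      have hbt : b = t := congrArg Subtype.val h
      exact htS (hbt ▸ hB₀S hb)
    have h := T.basis.repr_self ⟨b, hbT⟩
    rw [basis_apply] at h
    simp only [SetLike.mem_coe, LinearMap.mem_ker, Module.Basis.coord_apply, h]
    exact Finsupp.single_eq_of_ne' hbt
  exact hle (Submodule.span_le.2 hSB₀ hyS)

open scoped Classical in
/-- The change of weights which increases the weight of `s` and compensates on the frame `T`. -/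
def exchange (T : Frame V) (F : Finset E) (s : E) (v : F) : ℝ :=
  (if (v : E) = s then 1 else 0) - (if h : (v : E) ∈ T.1 then T.basis.repr s ⟨v, h⟩ else 0)

lemma sum_exchange (T : Frame V) {F : Finset E} (hTF : ∀ t : T.1, (t : E) ∈ F) {s : E}
    (hs : s ∈ F) {M : Type*} [AddCommGroup M] [Module ℝ M] (g : E → M) :
    ∑ v, T.exchange F s v • g v = g s - ∑ t : T.1, T.basis.repr s t • g t := by
  classical
  simp only [exchange, sub_smul, Finset.sum_sub_distrib]
  congr 1
  · rw [Finset.sum_eq_single (⟨s, hs⟩ : F)]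
    · simp
    · intro b _ hb
      rw [if_neg (fun h => hb (Subtype.ext h)), zero_smul]
    · simp
  · symm
    refine Finset.sum_of_injOn (fun t : T.1 => (⟨t, hTF t⟩ : F)) ?_ ?_ ?_ ?_
    · intro a _ b _ h
      exact Subtype.ext (congrArg (fun x : F => (x : E)) h)
    · simp
    · intro v _ hv
      rw [dif_neg, zero_smul]
      intro h
      exact hv ⟨⟨v, h⟩, by simp, rfl⟩
    · intro t _
      simp

lemma exists_mem_triangulation [TopologicalSpace E] [T1Space E] [ContinuousAdd E]
    [ContinuousSMul ℝ E] {U : Set (E →ₗ[ℝ] ℝ)} {ω : E → ℝ}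
    (hω : ∀ (T : Frame V), ∀ s ∈ V, s ∉ T.1 → T.height ω s ≠ ω s)
    (hV : Submodule.span ℝ (V : Set E) = ⊤)
    {u : E →ₗ[ℝ] ℝ} (hu : u ∈ U) (hu1 : ∀ v ∈ V, u v ≤ 1) {y : E} (hy : IsGeneric V y)
    {Λ₀ : E → ℝ} (hΛ₀ : ∀ v ∈ V, 0 ≤ Λ₀ v) (hsum : ∑ v ∈ V, Λ₀ v • v = y)
    (htot : ∑ v ∈ V, Λ₀ v = u y) :
    ∃ T ∈ triangulation V U ω, ∀ t, 0 < T.basis.repr y t := by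
  classical
  set F : Finset E := V.filter (fun v => u v = 1) with hF
  have hzero : ∀ v ∈ V, v ∉ F → Λ₀ v = 0 := by
    intro v hv hvF
    by_contra hne
    have hlt : u y < ∑ v ∈ V, Λ₀ v := by
      rw [← hsum, map_sum]
      refine Finset.sum_lt_sum (fun w hw => ?_) ⟨v, hv, ?_⟩
      · rw [map_smul, smul_eq_mul]
        exact mul_le_of_le_one_right (hΛ₀ w hw) (hu1 w hw)
      · rw [map_smul, smul_eq_mul]
        have h1 : u v < 1 := lt_of_le_of_ne (hu1 v hv) fun h =>
          hvF (Finset.mem_filter.2 ⟨hv, h⟩)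
        exact mul_lt_of_lt_one_right (lt_of_le_of_ne (hΛ₀ v hv) (Ne.symm hne)) h1
    exact hlt.ne htot.symm
  set K : Set (F → ℝ) := {Λ | (∀ v, 0 ≤ Λ v) ∧ ∑ v, Λ v • (v : E) = y} with hK
  have hKne : (fun v : F => Λ₀ v) ∈ K := by
    refine ⟨fun v => hΛ₀ v (Finset.mem_filter.1 v.2).1, ?_⟩
    rw [Finset.sum_coe_sort F (fun v => Λ₀ v • v), ← hsum]
    refine Finset.sum_subset (Finset.filter_subset _ _) fun v hv hvF => ?_
    rw [hzero v hv hvF, zero_smul]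
  have hKsub : K ⊆ Set.Icc 0 (fun _ => u y) := by
    rintro Λ ⟨h0, hs⟩
    refine ⟨h0, fun v => ?_⟩
    have hs' : ∑ v, Λ v = u y := by
      rw [← hs, map_sum]
      refine Finset.sum_congr rfl fun v _ => ?_
      rw [map_smul, (Finset.mem_filter.1 v.2).2, smul_eq_mul, mul_one]
    change Λ v ≤ u y
    rw [← hs']
    exact Finset.single_le_sum (fun v _ => h0 v) (Finset.mem_univ v)
  have hKcl : IsClosed K := by
    refine IsClosed.inter ?_ ?_
    · exact (isClosed_Ici : IsClosed (Set.Ici (0 : F → ℝ)))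
    · exact (isClosed_singleton (x := y)).preimage
        (f := fun Λ : F → ℝ => ∑ v, Λ v • (v : E)) (by fun_prop)
  have hKc : IsCompact K := isCompact_Icc.of_isClosed_subset hKcl hKsub
  obtain ⟨Λ, hΛK, hmin⟩ := hKc.exists_isMinOn ⟨_, hKne⟩
    (f := fun Λ : F → ℝ => ∑ v, Λ v * ω v) (by fun_prop)
  have hmin' : ∀ Λ' : F → ℝ, (∀ i, 0 ≤ Λ' i) → ∑ i, Λ' i • (i : E) = y →
      ∑ i, Λ i * ω i ≤ ∑ i, Λ' i * ω i := fun Λ' h1 h2 => hmin ⟨h1, h2⟩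
  obtain ⟨T, hTS⟩ := exists_frame_subset (S := {v | ∃ h : v ∈ F, 0 < Λ ⟨v, h⟩}) hV
    (fun v ⟨h, _⟩ => (Finset.mem_filter.1 h).1) hy (by
      rw [← hΛK.2]
      refine Submodule.sum_mem _ fun v _ => ?_
      rcases (hΛK.1 v).eq_or_lt with h | h
      · rw [← h, zero_smul]; exact Submodule.zero_mem _
      · exact Submodule.smul_mem _ _ (Submodule.subset_span ⟨v.2, h⟩))
  have hTF : ∀ t : T.1, (t : E) ∈ F := fun t => (hTS t.2).1
  have hTpos : ∀ t : T.1, 0 < Λ ⟨t, hTF t⟩ := fun t => (hTS t.2).2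
  let dir : E → F → ℝ := T.exchange F
  have hdir0 : ∀ s ∈ F, ∑ v, dir s v • (v : E) = 0 := by
    intro s hs
    rw [sum_exchange T hTF hs (fun v => v)]
    have := T.basis.sum_repr s
    simp only [basis_apply] at this
    rw [this, sub_self]
  have hdirω : ∀ s ∈ F, ∑ v, dir s v * ω v = ω s - T.height ω s := by
    intro s hs
    rw [apply_eq_sum T]
    simp only [height_mem]
    exact sum_exchange T hTF hs ω
  have hlt : ∀ s ∈ F, s ∉ T.1 → T.height ω s < ω s := by
    intro s hs hsT
    have h := objective_nonneg_of_isMinOn hΛK.1 hΛK.2 hmin' (hdir0 s hs) (fun v => by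
      by_cases hv : (v : E) ∈ T.1
      · exact Or.inl (hTpos ⟨v, hv⟩)
      · refine Or.inr ?_
        simp only [dir, exchange, hv, dite_false, sub_zero]
        split_ifs <;> norm_num)
    rw [hdirω s hs] at h
    exact lt_of_le_of_ne (by linarith) (hω T s (Finset.mem_filter.1 hs).1 hsT)
  have hoff : ∀ s : F, (s : E) ∉ T.1 → Λ s = 0 := by
    intro s hsT
    by_contra hne
    have hpos : 0 < Λ s := lt_of_le_of_ne (hΛK.1 s) (Ne.symm hne)
    have h := objective_nonneg_of_isMinOn (dir := fun v => -dir s v) hΛK.1 hΛK.2 hmin'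
      (by simp only [neg_smul, Finset.sum_neg_distrib, hdir0 s s.2, neg_zero]) (fun v => by
        by_cases hv : (v : E) ∈ T.1
        · exact Or.inl (hTpos ⟨v, hv⟩)
        · by_cases hvs : v = s
          · exact Or.inl (hvs ▸ hpos)
          · refine Or.inr ?_
            have : (v : E) ≠ s := fun h => hvs (Subtype.ext h)
            simp [dir, exchange, hv, this])
    simp only [neg_mul, Finset.sum_neg_distrib, hdirω s s.2] at h
    have := hlt s s.2 hsT
    linarith
  refine ⟨T, ⟨u, hu, fun t ht => (Finset.mem_filter.1 (hTF ⟨t, ht⟩)).2, fun s hs hs1 hsT =>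
    hlt s (Finset.mem_filter.2 ⟨hs, hs1⟩) hsT⟩, fun t => ?_⟩
  have hrepr : T.basis.repr y t = Λ ⟨t, hTF t⟩ := by
    rw [← hΛK.2, map_sum, Finsupp.finsetSum_apply,
      Finset.sum_eq_single (⟨t, hTF t⟩ : F)]
    · have h := T.basis.repr_self t
      rw [basis_apply] at h
      simp [h]
    · intro v _ hv
      by_cases hvT : (v : E) ∈ T.1
      · have h := T.basis.repr_self ⟨v, hvT⟩
        rw [basis_apply] at h
        have hvt : (⟨v, hvT⟩ : T.1) ≠ t := fun h =>
          hv (Subtype.ext (congrArg Subtype.val h : (v : E) = t))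
        simp only [map_smul, Finsupp.smul_apply, h, Finsupp.single_eq_of_ne' hvt, smul_zero]
      · rw [hoff v hvT, zero_smul, map_zero, Finsupp.zero_apply]
    · simp
  rw [hrepr]
  exact hTpos t

/-- Membership in the half-open cone over `T`: the points whose small translates in direction `q`
lie in the interior of the cone. -/
def HalfOpen (T : Frame V) (q x : E) : Prop :=
  ∀ t, 0 < T.basis.repr x t ∨ (T.basis.repr x t = 0 ∧ 0 < T.basis.repr q t)

lemma eventually_pos_iff {a b : ℝ} (hb : b ≠ 0) :
    ∀ᶠ ε : ℝ in nhdsWithin 0 (Set.Ioi 0),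
      a + ε * b ≠ 0 ∧ (0 < a + ε * b ↔ 0 < a ∨ (a = 0 ∧ 0 < b)) := by
  have hc : Continuous fun ε : ℝ => a + ε * b := by fun_prop
  have ht : Filter.Tendsto (fun ε : ℝ => a + ε * b) (nhdsWithin 0 (Set.Ioi 0)) (nhds a) := by
    have : Filter.Tendsto (fun ε : ℝ => a + ε * b) (nhds 0) (nhds a) := by
      simpa using hc.tendsto 0
    exact this.mono_left nhdsWithin_le_nhds
  rcases lt_trichotomy a 0 with h | h | h
  · filter_upwards [ht.eventually (gt_mem_nhds h)] with ε hε
    exact ⟨hε.ne, ⟨fun h' => absurd h' hε.not_gt, by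
      rintro (h' | ⟨h', -⟩) <;> linarith⟩⟩
  · filter_upwards [self_mem_nhdsWithin] with ε hε
    have hε : 0 < ε := hε
    subst h
    refine ⟨by simp [hε.ne', hb], ?_⟩
    simp [hε]
  · filter_upwards [ht.eventually (lt_mem_nhds h)] with ε hε
    exact ⟨hε.ne', ⟨fun _ => Or.inl h, fun _ => hε⟩⟩

/-- The half-open cones of a triangulation partition the space. -/
lemma existsUnique_halfOpen [TopologicalSpace E] [T1Space E] [ContinuousAdd E]
    [ContinuousSMul ℝ E] {U : Set (E →ₗ[ℝ] ℝ)} {ω : E → ℝ}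
    (hω : ∀ (T : Frame V), ∀ s ∈ V, s ∉ T.1 → T.height ω s ≠ ω s)
    (hV : Submodule.span ℝ (V : Set E) = ⊤) (hU : ∀ u ∈ U, ∀ v ∈ V, u v ≤ 1)
    (hcover : ∀ y : E, ∃ u ∈ U, ∃ Λ : E → ℝ, (∀ v ∈ V, 0 ≤ Λ v) ∧ ∑ v ∈ V, Λ v • v = y ∧
      ∑ v ∈ V, Λ v = u y) {q : E} (hq : IsGeneric V q) (x : E) :
    ∃! T : Frame V, T ∈ triangulation V U ω ∧ T.HalfOpen q x := by
  have hev : ∀ᶠ ε : ℝ in nhdsWithin 0 (Set.Ioi 0), ∀ (T : Frame V) (t : T.1),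
      T.basis.repr (x + ε • q) t ≠ 0 ∧ (0 < T.basis.repr (x + ε • q) t ↔
        0 < T.basis.repr x t ∨ (T.basis.repr x t = 0 ∧ 0 < T.basis.repr q t)) := by
    rw [Filter.eventually_all]
    intro T
    rw [Filter.eventually_all]
    intro t
    simpa using eventually_pos_iff (a := T.basis.repr x t) (hq T t)
  obtain ⟨ε, hε⟩ := hev.exists
  have hiff : ∀ T : Frame V, T.HalfOpen q x ↔ ∀ t, 0 < T.basis.repr (x + ε • q) t :=
    fun T => forall_congr' fun t => (hε T t).2.symm
  obtain ⟨u, hu, Λ, hΛ, hs, ht⟩ := hcover (x + ε • q)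
  obtain ⟨T, hT, hpos⟩ := exists_mem_triangulation (U := U) hω hV hu (hU u hu)
    (fun T t => (hε T t).1) hΛ hs ht
  refine ⟨T, ⟨hT, (hiff T).2 hpos⟩, fun T' hT' => ?_⟩
  exact triangulation_subsingleton hU hT'.1 hT ((hiff T').1 hT'.2) hpos

end Frame

/-- The box condition on one coordinate: `[0, 1)` for a closed side, `(0, 1]` for an open one. -/
def InUnit (a : Prop) (r : ℝ) : Prop := (0 < r ∧ r < 1) ∨ (r = 0 ∧ a) ∨ (r = 1 ∧ ¬a)

lemma InUnit.one_sub {a : Prop} {r : ℝ} (h : InUnit a r) : InUnit (¬a) (1 - r) := by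
  rcases h with h | ⟨rfl, h⟩ | ⟨rfl, h⟩
  · exact Or.inl ⟨by linarith, by linarith⟩
  · exact Or.inr (Or.inr ⟨by norm_num, by simpa using h⟩)
  · exact Or.inr (Or.inl ⟨by norm_num, h⟩)

lemma InUnit.nonneg {a : Prop} {r : ℝ} (h : InUnit a r) : 0 ≤ r := by
  rcases h with h | h | h <;> linarith [h.1]

lemma InUnit.le_one {a : Prop} {r : ℝ} (h : InUnit a r) : r ≤ 1 := by
  rcases h with h | h | h
  · exact h.2.le
  · linarith [h.1]
  · exact h.1.le

lemma InUnit.add_natCast {a : Prop} {r : ℝ} (h : InUnit a r) (n : ℕ) :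
    0 < r + n ∨ (r + n = 0 ∧ a) := by
  have hn : (0 : ℝ) ≤ n := n.cast_nonneg
  rcases h with h | ⟨rfl, h⟩ | ⟨rfl, h⟩
  · left; linarith [h.1]
  · rcases hn.eq_or_lt with hn | hn
    · exact Or.inr ⟨by linarith, h⟩
    · left; linarith
  · left; linarith

lemma exists_inUnit_sub_natCast {a : Prop} {r : ℝ} (h : 0 < r ∨ (r = 0 ∧ a)) :
    ∃ n : ℕ, InUnit a (r - n) := by
  have hr : 0 ≤ r := by rcases h with h | h <;> linarith [h]
  have h1 := Nat.floor_le hr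
  have h2 := Nat.lt_floor_add_one r
  rcases h1.eq_or_lt with he | hlt
  · by_cases ha : a
    · exact ⟨⌊r⌋₊, Or.inr (Or.inl ⟨by linarith, ha⟩)⟩
    · have hpos : 0 < r := h.resolve_right fun h => ha h.2
      have hf : 0 < ⌊r⌋₊ := by
        have : (0 : ℝ) < ⌊r⌋₊ := by linarith
        exact_mod_cast this
      refine ⟨⌊r⌋₊ - 1, Or.inr (Or.inr ⟨?_, ha⟩)⟩
      rw [Nat.cast_sub hf]
      push_cast
      linarith
  · exact ⟨⌊r⌋₊, Or.inl ⟨by linarith, by linarith⟩⟩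

lemma InUnit.eq_of_add_eq {a : Prop} {r s : ℝ} (hr : InUnit a r) (hs : InUnit a s) {m n : ℕ}
    (h : r + m = s + n) : m = n := by
  have key : ∀ {r s : ℝ} {m n : ℕ}, InUnit a r → InUnit a s → r + m = s + n → m ≤ n := by
    intro r s m n hr hs h
    by_contra! hlt
    have hc : (n : ℝ) + 1 ≤ m := by exact_mod_cast hlt
    have hr0 : r = 0 := le_antisymm (by linarith [hs.le_one]) hr.nonneg
    have hs1 : s = 1 := le_antisymm hs.le_one (by linarith [hr.nonneg])
    subst hr0 hs1
    simp only [InUnit, lt_self_iff_false, false_and, and_false, zero_ne_one, one_ne_zero,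
      true_and, false_or, or_false] at hr hs
    exact hs hr
  exact le_antisymm (key hr hs h) (key hs hr h.symm)

lemma card_sum_le (ι : Type*) [Fintype ι] (r : ℕ) :
    Nat.card {n : ι → ℕ // ∑ i, n i ≤ r} = (r + Fintype.card ι).choose (Fintype.card ι) := by
  classical
  let e : {n : ι → ℕ // ∑ i, n i ≤ r} ≃ {n : Option ι → ℕ // ∑ i, n i = r} :=
    { toFun := fun n => ⟨fun o => o.elim (r - ∑ i, n.1 i) n.1, by
        have := n.2
        simp only [Fintype.sum_option, Option.elim_none, Option.elim_some]
        omega⟩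
      invFun := fun n => ⟨fun i => n.1 (some i), by
        have := n.2
        rw [Fintype.sum_option] at this
        exact (Nat.le_add_left _ _).trans this.le⟩
      left_inv := fun n => rfl
      right_inv := fun n => by
        have := n.2
        rw [Fintype.sum_option] at this
        refine Subtype.ext (funext fun o => ?_)
        cases o with
        | none => simp only [Option.elim_none]; omega
        | some i => rfl }
  rw [Nat.card_congr (e.trans (Sym.equivNatSumOfFintype (Option ι) r).symm),
    Nat.card_eq_fintype_card, Sym.card_sym_eq_choose, Fintype.card_option,
    show Fintype.card ι + 1 + r - 1 = r + Fintype.card ι by omega]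
  exact Nat.choose_symm_add

/-- A lattice with coordinates relative to a simplicial cone on lattice vectors of degree one. -/
structure ConeData (M ι : Type*) [AddCommGroup M] [Fintype ι] where
  coord : M →+ (ι → ℝ)
  gen : ι → M
  deg : M →+ ℤ
  coord_gen_self : ∀ i, coord (gen i) i = 1
  coord_gen_ne : ∀ i j, i ≠ j → coord (gen i) j = 0
  deg_eq : ∀ x, (deg x : ℝ) = ∑ i, coord x i
  finite_bounded : {x | ∀ i, coord x i ∈ Set.Icc (0 : ℝ) 1}.Finite

namespace ConeData

variable {M ι : Type*} [AddCommGroup M] [Fintype ι] (D : ConeData M ι)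

/-- The half-open fundamental box of the cone. -/
def Box (a : ι → Prop) : Type _ := {x : M // ∀ i, InUnit (a i) (D.coord x i)}

/-- The half-open cone. -/
def HalfOpen (a : ι → Prop) (x : M) : Prop := ∀ i, 0 < D.coord x i ∨ (D.coord x i = 0 ∧ a i)

instance (a : ι → Prop) : Finite (D.Box a) :=
  (D.finite_bounded.subset fun _ hx i =>
    ⟨InUnit.nonneg (hx i), InUnit.le_one (hx i)⟩ : {x | ∀ i, InUnit (a i) (D.coord x i)}.Finite)

lemma coord_sum (n : ι → ℤ) (j : ι) : D.coord (∑ i, n i • D.gen i) j = n j := by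
  simp only [map_sum, map_zsmul, Finset.sum_apply, Pi.smul_apply]
  rw [Finset.sum_eq_single j]
  · simp [D.coord_gen_self]
  · intro i _ hij
    rw [D.coord_gen_ne i j hij, smul_zero]
  · simp

lemma deg_sum (n : ι → ℤ) : D.deg (∑ i, n i • D.gen i) = ∑ i, n i := by
  have h := D.deg_eq (∑ i, n i • D.gen i)
  simp only [coord_sum] at h
  exact_mod_cast h

lemma deg_mem {a : ι → Prop} (b : D.Box a) : 0 ≤ D.deg b.1 ∧ D.deg b.1 ≤ Fintype.card ι := by
  have h := D.deg_eq b.1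
  constructor
  · have : (0 : ℝ) ≤ D.deg b.1 := h ▸ Finset.sum_nonneg fun i _ => (b.2 i).nonneg
    exact_mod_cast this
  · have : (D.deg b.1 : ℝ) ≤ Fintype.card ι := by
      rw [h]
      refine (Finset.sum_le_sum fun i _ => (b.2 i).le_one).trans ?_
      simp
    exact_mod_cast this

/-- The central symmetry of the fundamental box. -/
def reflect (a : ι → Prop) : D.Box a ≃ D.Box (fun i => ¬a i) where
  toFun b := ⟨∑ i, (1 : ℤ) • D.gen i - b.1, fun i => by
    rw [map_sub, Pi.sub_apply, D.coord_sum, Int.cast_one]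
    exact (b.2 i).one_sub⟩
  invFun b := ⟨∑ i, (1 : ℤ) • D.gen i - b.1, fun i => by
    rw [map_sub, Pi.sub_apply, D.coord_sum, Int.cast_one]
    simpa using (b.2 i).one_sub⟩
  left_inv b := Subtype.ext (sub_sub_cancel _ _)
  right_inv b := Subtype.ext (sub_sub_cancel _ _)

lemma deg_reflect (a : ι → Prop) (b : D.Box a) :
    D.deg (D.reflect a b).1 = Fintype.card ι - D.deg b.1 := by
  have h : (D.reflect a b).1 = ∑ i, (1 : ℤ) • D.gen i - b.1 := rfl
  rw [h, map_sub, D.deg_sum]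
  simp

/-- Every point of the half-open cone is uniquely a box point plus a combination of the
generators with natural coefficients. -/
lemma bijective_box_add (a : ι → Prop) (m : ℕ) :
    Function.Bijective
      (fun p : Σ b : D.Box a, {n : ι → ℕ // D.deg b.1 + ∑ i, (n i : ℤ) ≤ m} =>
        (⟨p.1.1 + ∑ i, (p.2.1 i : ℤ) • D.gen i, by
          refine ⟨fun i => ?_, ?_⟩
          · rw [map_add, Pi.add_apply, D.coord_sum]
            exact_mod_cast (p.1.2 i).add_natCast _
          · rw [map_add, D.deg_sum]
            exact p.2.2⟩ : {x : M // D.HalfOpen a x ∧ D.deg x ≤ m})) := by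
  constructor
  · rintro ⟨b, n, hn⟩ ⟨b', n', hn'⟩ h
    have h' : b.1 + ∑ i, (n i : ℤ) • D.gen i = b'.1 + ∑ i, (n' i : ℤ) • D.gen i :=
      congrArg Subtype.val h
    have hnn : n = n' := by
      funext i
      have hi := congrFun (congrArg D.coord h') i
      rw [map_add, map_add, Pi.add_apply, Pi.add_apply, D.coord_sum, D.coord_sum] at hi
      exact (b.2 i).eq_of_add_eq (b'.2 i) (by exact_mod_cast hi)
    subst hnn
    have hbb : b = b' := Subtype.ext (add_right_cancel h')
    subst hbb
    rfl
  · rintro ⟨x, hx, hdeg⟩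
    choose n hn using fun i => exists_inUnit_sub_natCast (hx i)
    refine ⟨⟨⟨x - ∑ i, (n i : ℤ) • D.gen i, fun i => ?_⟩, n, ?_⟩, ?_⟩
    · rw [map_sub, Pi.sub_apply, D.coord_sum]
      exact_mod_cast hn i
    · rw [map_sub, D.deg_sum]
      linarith
    · exact Subtype.ext (sub_add_cancel _ _)

lemma card_halfOpen (a : ι → Prop) [Fintype (D.Box a)] (m : ℕ) :
    Finite {x : M // D.HalfOpen a x ∧ D.deg x ≤ m} ∧
    Nat.card {x : M // D.HalfOpen a x ∧ D.deg x ≤ m} =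
      ∑ b : D.Box a, (m + Fintype.card ι - (D.deg b.1).toNat).choose (Fintype.card ι) := by
  have hcard : ∀ b : D.Box a, Finite {n : ι → ℕ // D.deg b.1 + ∑ i, (n i : ℤ) ≤ m} ∧
      Nat.card {n : ι → ℕ // D.deg b.1 + ∑ i, (n i : ℤ) ≤ m} =
        (m + Fintype.card ι - (D.deg b.1).toNat).choose (Fintype.card ι) := by
    intro b
    obtain ⟨k, hk⟩ := Int.eq_ofNat_of_zero_le (D.deg_mem b).1
    rw [hk, Int.toNat_natCast]
    have hkd := (D.deg_mem b).2
    by_cases hkm : k ≤ m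
    · have hset : {n : ι → ℕ | (k : ℤ) + ∑ i, (n i : ℤ) ≤ m} = {n | ∑ i, n i ≤ m - k} := by
        ext n
        simp only [Set.mem_ofPred_eq, ← Nat.cast_sum]
        omega
      have hc : Nat.card {n : ι → ℕ // (k : ℤ) + ∑ i, (n i : ℤ) ≤ m} =
          (m + Fintype.card ι - k).choose (Fintype.card ι) := by
        refine (congrArg (fun s : Set (ι → ℕ) => Nat.card s) hset).trans ?_
        refine (card_sum_le ι (m - k)).trans ?_
        rw [show m - k + Fintype.card ι = m + Fintype.card ι - k by omega]
      refine ⟨Nat.finite_of_card_ne_zero ?_, hc⟩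
      rw [hc]
      exact (Nat.choose_pos (by omega)).ne'
    · have hemp : IsEmpty {n : ι → ℕ // (k : ℤ) + ∑ i, (n i : ℤ) ≤ m} := ⟨fun n => by
        have := n.2
        rw [← Nat.cast_sum] at this
        omega⟩
      refine ⟨inferInstance, ?_⟩
      rw [Nat.card_of_isEmpty, Nat.choose_eq_zero_of_lt (by omega)]
  have hfin := fun b => (hcard b).1
  refine ⟨Finite.of_surjective _ (D.bijective_box_add a m).2, ?_⟩
  rw [← Nat.card_congr (Equiv.ofBijective _ (D.bijective_box_add a m)), Nat.card_sigma]
  exact Finset.sum_congr rfl fun b _ => (hcard b).2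

end ConeData

/-- The inclusion of the integer lattice. -/
def latticeEmb (d : ℕ) : (Fin d → ℤ) →+ (Fin d → ℝ) where
  toFun v i := v i
  map_zero' := by ext; simp
  map_add' x y := by ext; simp

lemma latticeEmb_injective (d : ℕ) : Function.Injective (latticeEmb d) := fun x y h => by
  funext i
  have hi : (x i : ℝ) = y i := congrFun h i
  exact_mod_cast hi

/-- The linear functional `x ↦ -⟨w, x⟩`. -/
def facetFun {d : ℕ} (w : Fin d → ℤ) : (Fin d → ℝ) →ₗ[ℝ] ℝ where
  toFun x := -∑ i, (w i : ℝ) * x i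
  map_add' x y := by
    simp only [Pi.add_apply, mul_add, Finset.sum_add_distrib]
    ring
  map_smul' c x := by
    simp only [Pi.smul_apply, smul_eq_mul, RingHom.id_apply, mul_neg, Finset.mul_sum]
    congr 1
    exact Finset.sum_congr rfl fun i _ => by ring

/-- The functional `x ↦ -⟨w, x⟩` on the integer lattice. -/
def latticeDeg {d : ℕ} (w : Fin d → ℤ) : (Fin d → ℤ) →+ ℤ where
  toFun x := -∑ i, w i * x i
  map_zero' := by simp
  map_add' x y := by
    simp only [Pi.add_apply, mul_add, Finset.sum_add_distrib]
    ring

lemma cast_latticeDeg {d : ℕ} (w x : Fin d → ℤ) :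
    (latticeDeg w x : ℝ) = facetFun w (latticeEmb d x) := by
  simp [latticeDeg, facetFun, latticeEmb]

section Reflexive

variable {d : ℕ} {P : Set (Fin d → ℝ)} {V W : Finset (Fin d → ℤ)}

open scoped Classical in
/-- The finite set of real vectors underlying a finite set of lattice vectors. -/
def realVertices (V : Finset (Fin d → ℤ)) : Finset (Fin d → ℝ) := V.image (latticeEmb d)

lemma coe_realVertices (V : Finset (Fin d → ℤ)) :
    (realVertices V : Set (Fin d → ℝ)) =
      (fun v : Fin d → ℤ => fun i => (v i : ℝ)) '' (V : Set (Fin d → ℤ)) := by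
  classical
  exact Finset.coe_image

lemma mem_realVertices {v : Fin d → ℝ} :
    v ∈ realVertices V ↔ ∃ z ∈ V, latticeEmb d z = v := by
  classical
  exact Finset.mem_image

/-- The half-space description of a polytope containing the origin from its dual. -/
lemma mem_iff_facetFun_le (hP : P = convexHull ℝ (realVertices V : Set (Fin d → ℝ)))
    (h0 : (0 : Fin d → ℝ) ∈ P)
    (hW : dualBody d P = convexHull ℝ (realVertices W : Set (Fin d → ℝ))) (x : Fin d → ℝ) :
    x ∈ P ↔ ∀ w ∈ W, facetFun w x ≤ 1 := by
  constructor
  · intro hx w hw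
    have hmem : latticeEmb d w ∈ dualBody d P := by
      rw [hW]
      exact subset_convexHull ℝ _ (mem_realVertices.2 ⟨w, hw, rfl⟩)
    have h : -1 ≤ ∑ i, (w i : ℝ) * x i := hmem x hx
    change -∑ i, (w i : ℝ) * x i ≤ 1
    linarith
  · intro hx
    by_contra hxP
    have hcl : IsClosed P := by
      rw [hP]
      exact (Finset.finite_toSet _).isClosed_convexHull ℝ
    have hcv : Convex ℝ P := hP ▸ convex_convexHull ℝ _
    obtain ⟨f, c, hfc, hcx⟩ := geometric_hahn_banach_closed_point hcv hcl hxP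
    have hc : 0 < c := by simpa using hfc 0 h0
    have hf : ∀ z : Fin d → ℝ, f z = ∑ i, f (Pi.single i 1) * z i := by
      intro z
      conv_lhs => rw [← Finset.univ_sum_single z, map_sum]
      refine Finset.sum_congr rfl fun i _ => ?_
      have : (Pi.single i (z i) : Fin d → ℝ) = z i • Pi.single i 1 := by
        rw [← Pi.single_smul, smul_eq_mul, mul_one]
      rw [this, map_smul, smul_eq_mul, mul_comm]
    have hg : ∀ z : Fin d → ℝ, ∑ i, (-(f (Pi.single i 1)) / c) * z i = -(f z) / c := by
      intro z
      rw [hf z, ← Finset.sum_neg_distrib, Finset.sum_div]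
      exact Finset.sum_congr rfl fun i _ => by ring
    have hmem : (fun i => -(f (Pi.single i 1)) / c) ∈ dualBody d P := by
      intro v hv
      rw [hg, le_div_iff₀ hc]
      linarith [hfc v hv]
    rw [hW] at hmem
    have hhalf : Convex ℝ {u : Fin d → ℝ | -1 ≤ ∑ i, u i * x i} :=
      convex_halfSpace_ge (IsLinearMap.mk
        (fun u v => by simp only [Pi.add_apply, add_mul, Finset.sum_add_distrib])
        (fun a u => by simp only [Pi.smul_apply, smul_eq_mul, mul_assoc, Finset.mul_sum])) _
    have hsub : (realVertices W : Set (Fin d → ℝ)) ⊆ {u | -1 ≤ ∑ i, u i * x i} := by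
      intro u hu
      obtain ⟨w, hw, rfl⟩ := mem_realVertices.1 hu
      have h : -∑ i, (w i : ℝ) * x i ≤ 1 := hx w hw
      change -1 ≤ ∑ i, (w i : ℝ) * x i
      linarith
    have h : -1 ≤ ∑ i, (-(f (Pi.single i 1)) / c) * x i := convexHull_min hsub hhalf hmem
    rw [hg, le_div_iff₀ hc] at h
    linarith

lemma exists_facet_weights (hP : P = convexHull ℝ (realVertices V : Set (Fin d → ℝ)))
    (hWne : W.Nonempty) (hmem : ∀ x, x ∈ P ↔ ∀ w ∈ W, facetFun w x ≤ 1) (y : Fin d → ℝ) :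
    ∃ u ∈ facetFun '' (W : Set (Fin d → ℤ)), ∃ Λ : (Fin d → ℝ) → ℝ,
      (∀ v ∈ realVertices V, 0 ≤ Λ v) ∧ ∑ v ∈ realVertices V, Λ v • v = y ∧
      ∑ v ∈ realVertices V, Λ v = u y := by
  by_cases hy : y = 0
  · obtain ⟨w, hw⟩ := hWne
    exact ⟨_, ⟨w, hw, rfl⟩, 0, by simp, by simp [hy], by simp [hy]⟩
  obtain ⟨w, hw, hmax⟩ := W.exists_max_image (fun w => facetFun w y) hWne
  have hpos : 0 < facetFun w y := by
    by_contra! hle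
    have hall : ∀ n : ℕ, (n : ℝ) • y ∈ P := fun n => (hmem _).2 fun w' hw' => by
      rw [map_smul, smul_eq_mul]
      have h := (hmax w' hw').trans hle
      exact (mul_nonpos_of_nonneg_of_nonpos n.cast_nonneg h).trans zero_le_one
    have hb : Bornology.IsBounded P := by
      rw [hP]
      exact ((Finset.finite_toSet _).isCompact_convexHull ℝ).isBounded
    obtain ⟨C, hC⟩ := hb.exists_norm_le
    obtain ⟨n, hn⟩ := exists_nat_gt (C / ‖y‖)
    have h := hC _ (hall n)
    rw [norm_smul, Real.norm_natCast] at h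
    rw [div_lt_iff₀ (norm_pos_iff.2 hy)] at hn
    linarith
  have hyP : (facetFun w y)⁻¹ • y ∈ P := (hmem _).2 fun w' hw' => by
    rw [map_smul, smul_eq_mul, inv_mul_le_iff₀ hpos, mul_one]
    exact hmax w' hw'
  rw [hP, Finset.mem_convexHull'] at hyP
  obtain ⟨Λ, h0, h1, hs⟩ := hyP
  refine ⟨_, ⟨w, hw, rfl⟩, fun v => facetFun w y * Λ v,
    fun v hv => mul_nonneg hpos.le (h0 v hv), ?_, ?_⟩
  · simp only [mul_smul, ← Finset.smul_sum, hs]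
    rw [smul_inv_smul₀ hpos.ne']
  · rw [← Finset.mul_sum, h1, mul_one]

/-- The lattice cone data of a frame of lattice vectors in a face of degree one. -/
def Frame.coneData (T : Frame (realVertices V)) (w : Fin d → ℤ)
    (hw : ∀ t ∈ T.1, facetFun w t = 1) : ConeData (Fin d → ℤ) T.1 where
  coord :=
    { toFun := fun x t => T.basis.repr (latticeEmb d x) t
      map_zero' := by ext; simp
      map_add' := fun x y => by ext; simp }
  gen t := (mem_realVertices.1 (T.mem_vertices t)).choose
  deg := latticeDeg w
  coord_gen_self t := by
    have h := (mem_realVertices.1 (T.mem_vertices t)).choose_spec.2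
    change T.basis.repr (latticeEmb d _) t = 1
    rw [h, ← T.basis_apply t, T.basis.repr_self, Finsupp.single_eq_same]
  coord_gen_ne t s hts := by
    have h := (mem_realVertices.1 (T.mem_vertices t)).choose_spec.2
    change T.basis.repr (latticeEmb d _) s = 0
    rw [h, ← T.basis_apply t, T.basis.repr_self, Finsupp.single_eq_of_ne' hts]
  deg_eq x := by
    rw [cast_latticeDeg, T.apply_eq_sum]
    exact Finset.sum_congr rfl fun t _ => by rw [hw t t.2, mul_one]; rfl
  finite_bounded := by
    obtain ⟨B, hB⟩ : ∃ B : ℕ, ∀ i, ∑ t : T.1, |(t : Fin d → ℝ) i| ≤ B := by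
      obtain ⟨B, hB⟩ := exists_nat_ge (∑ i, ∑ t : T.1, |(t : Fin d → ℝ) i|)
      refine ⟨B, fun i => le_trans ?_ hB⟩
      exact Finset.single_le_sum (f := fun i => ∑ t : T.1, |(t : Fin d → ℝ) i|)
        (fun i _ => Finset.sum_nonneg fun t _ => abs_nonneg _) (Finset.mem_univ i)
    refine (Set.finite_Icc (fun _ : Fin d => -(B : ℤ)) (fun _ => (B : ℤ))).subset fun x hx => ?_
    have habs : ∀ i, |(x i : ℝ)| ≤ B := fun i => by
      have hsum : (x i : ℝ) = ∑ t : T.1, T.basis.repr (latticeEmb d x) t * (t : Fin d → ℝ) i :=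
        T.apply_eq_sum (LinearMap.proj i) (latticeEmb d x)
      rw [hsum]
      refine (Finset.abs_sum_le_sum_abs _ _).trans (le_trans ?_ (hB i))
      refine Finset.sum_le_sum fun t _ => ?_
      have ht : T.basis.repr (latticeEmb d x) t ∈ Set.Icc (0 : ℝ) 1 := hx t
      rw [abs_mul, abs_of_nonneg ht.1]
      exact mul_le_of_le_one_left (abs_nonneg _) ht.2
    have habs' : ∀ i, |x i| ≤ B := fun i => by exact_mod_cast habs i
    exact ⟨fun i => (abs_le.1 (habs' i)).1, fun i => (abs_le.1 (habs' i)).2⟩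

lemma mem_latticePts_smul_iff (hmem : ∀ x, x ∈ P ↔ ∀ w ∈ W, facetFun w x ≤ 1) {m : ℕ}
    (hm : 0 < m) (x : Fin d → ℤ) :
    x ∈ latticePts d ((m : ℝ) • P) ↔ ∀ w ∈ W, facetFun w (latticeEmb d x) ≤ m := by
  have hm' : (0 : ℝ) < m := by exact_mod_cast hm
  change latticeEmb d x ∈ (m : ℝ) • P ↔ _
  rw [Set.mem_smul_set_iff_inv_smul_mem₀ hm'.ne', hmem]
  refine forall₂_congr fun w _ => ?_
  rw [map_smul, smul_eq_mul, inv_mul_le_iff₀ hm', mul_one]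

/-- The lattice point counts of a reflexive polytope have an expansion in binomials and the
reflected expansion. -/
theorem exists_symmetric_binomial_expansion (hP : IsLatticePolytope d P) (hdim : IsFullDim d P)
    (href : IsReflexive d P) :
    ∃ (β : Type) (_ : Fintype β) (k : β → ℕ), (∀ b, k b ≤ d) ∧ ∀ m : ℕ, 0 < m →
      (latticePts d ((m : ℝ) • P)).ncard = ∑ b, (m + (d - k b)).choose d ∧
      (latticePts d ((m : ℝ) • P)).ncard = ∑ b, (m + k b).choose d := by
  classical
  obtain ⟨V, hV⟩ := hP
  obtain ⟨h0int, W, hW⟩ := href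
  rw [← coe_realVertices] at hV hW
  have h0 : (0 : Fin d → ℝ) ∈ P := interior_subset h0int
  have hmem := mem_iff_facetFun_le hV h0 hW
  have hWne : W.Nonempty := by
    have h : (convexHull ℝ (realVertices W : Set (Fin d → ℝ))).Nonempty :=
      hW ▸ ⟨0, fun v _ => by simp⟩
    obtain ⟨w, hw⟩ := convexHull_nonempty_iff.1 h
    obtain ⟨z, hz, -⟩ := mem_realVertices.1 hw
    exact ⟨z, hz⟩
  have hspan : Submodule.span ℝ (realVertices V : Set (Fin d → ℝ)) = ⊤ := by
    have h : affineSpan ℝ (realVertices V : Set (Fin d → ℝ)) = ⊤ := by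
      rw [← affineSpan_convexHull, ← hV]
      exact hdim
    rw [eq_top_iff]
    intro x _
    exact affineSpan_subset_span (h ▸ AffineSubspace.mem_top ℝ _ x)
  obtain ⟨ω, hω⟩ := Frame.exists_heights (realVertices V)
  obtain ⟨q, hq⟩ := Frame.exists_isGeneric (realVertices V)
  have hU : ∀ u ∈ facetFun '' (W : Set (Fin d → ℤ)), ∀ v ∈ realVertices V, u v ≤ 1 := by
    rintro _ ⟨w, hw, rfl⟩ v hv
    exact (hmem v).1 (hV ▸ subset_convexHull ℝ _ hv) w hw
  set 𝒯 := Frame.triangulation (realVertices V) (facetFun '' (W : Set (Fin d → ℤ))) ω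
  have hfacet : ∀ T : 𝒯, ∃ w ∈ W, ∀ t ∈ T.1.1, facetFun w t = 1 := by
    rintro ⟨T, _, ⟨w, hw, rfl⟩, h, -⟩
    exact ⟨w, hw, h⟩
  choose w hwW hw using hfacet
  let D : ∀ T : 𝒯, ConeData (Fin d → ℤ) T.1.1 := fun T => T.1.coneData (w T) (hw T)
  have hcardT : ∀ T : 𝒯, Fintype.card T.1.1 = d := fun T => by
    rw [← Module.finrank_eq_card_basis T.1.basis, Module.finrank_fin_fun]
  have : Fintype 𝒯 := Fintype.ofFinite _
  have instBox : ∀ (T : 𝒯) (a : T.1.1 → Prop), Fintype ((D T).Box a) :=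
    fun T a => Fintype.ofFinite _
  have hcount : ∀ q' : Fin d → ℝ, Frame.IsGeneric (realVertices V) q' → ∀ m : ℕ, 0 < m →
      (latticePts d ((m : ℝ) • P)).ncard = ∑ T : 𝒯,
        ∑ b : (D T).Box (fun t => 0 < T.1.basis.repr q' t),
          (m + d - ((D T).deg b.1).toNat).choose d := by
    intro q' hq' m hm
    have hiff : ∀ (T : 𝒯) (x : Fin d → ℤ), T.1.HalfOpen q' (latticeEmb d x) →
        (x ∈ latticePts d ((m : ℝ) • P) ↔ (D T).deg x ≤ m) := by
      intro T x hx
      have hdeg : (D T).deg x ≤ m ↔ facetFun (w T) (latticeEmb d x) ≤ m := by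
        rw [← cast_latticeDeg]
        change latticeDeg (w T) x ≤ m ↔ _
        exact_mod_cast Iff.rfl
      rw [hdeg, mem_latticePts_smul_iff hmem hm]
      refine ⟨fun h => h _ (hwW T), fun h w' hw' => le_trans ?_ h⟩
      rw [T.1.apply_eq_sum (facetFun w'), T.1.apply_eq_sum (facetFun (w T))]
      refine Finset.sum_le_sum fun t _ => mul_le_mul_of_nonneg_left ?_ ?_
      · rw [hw T t t.2]
        exact hU _ ⟨w', hw', rfl⟩ t (T.1.mem_vertices t)
      · rcases hx t with h | h
        · exact h.le
        · exact h.1.ge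
    have hpart := Frame.existsUnique_halfOpen hω hspan hU
      (exists_facet_weights hV hWne hmem) hq'
    have hbij : Function.Bijective (fun p : Σ T : 𝒯, {x : Fin d → ℤ //
        (D T).HalfOpen (fun t => 0 < T.1.basis.repr q' t) x ∧ (D T).deg x ≤ m} =>
          (⟨p.2.1, (hiff p.1 p.2.1 p.2.2.1).2 p.2.2.2⟩ : latticePts d ((m : ℝ) • P))) := by
      constructor
      · rintro ⟨T, x, hx⟩ ⟨T', x', hx'⟩ h
        have hxx : x = x' := congrArg Subtype.val h
        subst hxx
        have hTT : T = T' := Subtype.ext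
          ((hpart (latticeEmb d x)).unique ⟨T.2, hx.1⟩ ⟨T'.2, hx'.1⟩)
        subst hTT
        rfl
      · rintro ⟨x, hx⟩
        obtain ⟨T, ⟨hT, hTx⟩, -⟩ := hpart (latticeEmb d x)
        exact ⟨⟨⟨T, hT⟩, x, hTx, (hiff ⟨T, hT⟩ x hTx).1 hx⟩, rfl⟩
    have hfin := fun T : 𝒯 => ((D T).card_halfOpen (fun t => 0 < T.1.basis.repr q' t) m).1
    rw [← Nat.card_coe_set_eq, ← Nat.card_congr (Equiv.ofBijective _ hbij), Nat.card_sigma]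
    refine Finset.sum_congr rfl fun T _ => ?_
    have h := ((D T).card_halfOpen (fun t => 0 < T.1.basis.repr q' t) m).2
    rw [hcardT T] at h
    exact h
  have hdegle : ∀ (T : 𝒯) {a : T.1.1 → Prop} (b : (D T).Box a),
      0 ≤ (D T).deg b.1 ∧ (D T).deg b.1 ≤ d := fun T a b => by
    have h := (D T).deg_mem b
    rwa [hcardT T] at h
  refine ⟨Σ T : 𝒯, (D T).Box (fun t => 0 < T.1.basis.repr q t), inferInstance,
    fun p => ((D p.1).deg p.2.1).toNat, fun p => ?_, fun m hm => ⟨?_, ?_⟩⟩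
  · have := hdegle p.1 p.2
    dsimp only
    omega
  · rw [hcount q hq m hm, Fintype.sum_sigma]
    refine Finset.sum_congr rfl fun T _ => Finset.sum_congr rfl fun b _ => ?_
    have := hdegle T b
    congr 1
    dsimp only
    omega
  · have hq' : Frame.IsGeneric (realVertices V) (-q) := fun T t => by
      simpa using hq T t
    rw [hcount (-q) hq' m hm, Fintype.sum_sigma]
    refine Finset.sum_congr rfl fun T _ => ?_
    have hside : (fun t => 0 < T.1.basis.repr (-q) t) = fun t => ¬ 0 < T.1.basis.repr q t := by
      funext t
      have := hq T.1 t
      simp only [map_neg, Finsupp.neg_apply, not_lt, eq_iff_iff]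
      exact ⟨fun h => by linarith, fun h => by linarith [lt_of_le_of_ne h this]⟩
    have hcongr : ∀ (a a' : T.1.1 → Prop), a = a' → ∑ b : (D T).Box a,
        (m + d - ((D T).deg b.1).toNat).choose d =
          ∑ b : (D T).Box a', (m + d - ((D T).deg b.1).toNat).choose d := by
      rintro a _ rfl
      rfl
    rw [hcongr _ _ hside, ← Equiv.sum_comp ((D T).reflect _)]
    refine Finset.sum_congr rfl fun b _ => ?_
    rw [ConeData.deg_reflect, hcardT T]
    have := hdegle T b
    congr 1
    dsimp only
    omega

end Reflexive

section LatticeCount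

variable {d : ℕ} {P : Set (Fin d → ℝ)}

lemma IsLatticePolytope.isCompact (hP : IsLatticePolytope d P) : IsCompact P := by
  obtain ⟨V, rfl⟩ := hP
  exact (V.finite_toSet.image _).isCompact_convexHull ℝ

lemma IsLatticePolytope.convex (hP : IsLatticePolytope d P) : Convex ℝ P := by
  obtain ⟨V, rfl⟩ := hP
  exact convex_convexHull ℝ _

lemma finite_latticePts_s9 (hP : Bornology.IsBounded P) : (latticePts d P).Finite := by
  obtain ⟨C, hC⟩ := hP.exists_norm_le
  obtain ⟨B, hB⟩ := exists_nat_ge C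
  refine (Set.finite_Icc (fun _ : Fin d => -(B : ℤ)) (fun _ => (B : ℤ))).subset fun x hx => ?_
  have habs : ∀ i, |x i| ≤ B := fun i => by
    have h : |(x i : ℝ)| ≤ B := ((norm_le_pi_norm (latticeEmb d x) i).trans (hC _ hx)).trans hB
    exact_mod_cast h
  exact ⟨fun i => (abs_le.1 (habs i)).1, fun i => (abs_le.1 (habs i)).2⟩

/-- A lattice polytope with the origin in its interior has at least `d + 1` nonzero lattice
points. -/
lemma add_two_le_ncard_latticePts [NeZero d] (hP : IsLatticePolytope d P) (hdim : IsFullDim d P)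
    (h0 : (0 : Fin d → ℝ) ∈ interior P) : d + 2 ≤ (latticePts d P).ncard := by
  classical
  have hfin := finite_latticePts_s9 hP.isCompact.isBounded
  obtain ⟨V, hV⟩ := hP
  rw [← coe_realVertices] at hV
  set R : Finset (Fin d → ℝ) := (realVertices V).erase 0 with hR
  have hspan : Submodule.span ℝ (R : Set (Fin d → ℝ)) = ⊤ := by
    have h : affineSpan ℝ (realVertices V : Set (Fin d → ℝ)) = ⊤ := by
      rw [← affineSpan_convexHull, ← hV]
      exact hdim
    rw [hR, Finset.coe_erase, Submodule.span_sdiff_singleton_zero, eq_top_iff]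
    intro x _
    exact affineSpan_subset_span (h ▸ AffineSubspace.mem_top ℝ _ x)
  have hle : d ≤ R.card := by
    have h := finrank_span_finset_le_card (R := ℝ) R
    rwa [Set.finrank, hspan, finrank_top, Module.finrank_fin_fun] at h
  have hne : d ≠ R.card := by
    intro hcard
    have hrange : Set.range (fun v : R => (v : Fin d → ℝ)) = (R : Set (Fin d → ℝ)) :=
      Subtype.range_coe
    have hli : LinearIndependent ℝ (fun v : R => (v : Fin d → ℝ)) :=
      linearIndependent_of_top_le_span_of_card_eq_finrank (by rw [hrange, hspan])
        (by rw [Fintype.card_coe, Module.finrank_fin_fun]; exact hcard.symm)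
    let b := Module.Basis.mk hli (by rw [hrange, hspan])
    let f : (Fin d → ℝ) →ₗ[ℝ] ℝ := b.constr ℝ (fun _ => (1 : ℝ))
    have hf : ∀ v ∈ R, f v = 1 := fun v hv => by
      have h := b.constr_basis ℝ (fun _ => (1 : ℝ)) ⟨v, hv⟩
      rwa [Module.Basis.mk_apply] at h
    have hfP : ∀ x ∈ P, 0 ≤ f x := by
      intro x hx
      rw [hV] at hx
      refine convexHull_min (t := {x | 0 ≤ f x}) (fun v hv => ?_)
        (convex_halfSpace_ge f.isLinear 0) hx
      by_cases hv0 : v = 0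
      · simp [hv0]
      · change 0 ≤ f v
        rw [hf v (Finset.mem_erase.2 ⟨hv0, hv⟩)]
        exact zero_le_one
    obtain ⟨v, hv⟩ : R.Nonempty :=
      Finset.card_pos.1 ((Nat.pos_of_ne_zero (NeZero.ne d)).trans_le hle)
    have hc : Continuous fun ε : ℝ => -ε • v := by fun_prop
    have ht : Filter.Tendsto (fun ε : ℝ => -ε • v) (nhds 0) (nhds 0) := by
      simpa using hc.tendsto 0
    have hev := (ht.eventually (mem_interior_iff_mem_nhds.1 h0)).filter_mono
      (nhdsWithin_le_nhds (s := Set.Ioi 0))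
    obtain ⟨ε, hε, hε0⟩ := (hev.and self_mem_nhdsWithin).exists
    have h := hfP _ hε
    rw [map_smul, hf v hv, smul_eq_mul, mul_one] at h
    have : (0 : ℝ) < ε := hε0
    linarith
  have hsub : (↑(insert 0 R) : Set (Fin d → ℝ)) ⊆ latticeEmb d '' latticePts d P := by
    intro x hx
    rcases Finset.mem_insert.1 (Finset.mem_coe.1 hx) with rfl | hx
    · refine ⟨0, ?_, map_zero _⟩
      change latticeEmb d 0 ∈ P
      rw [map_zero]
      exact interior_subset h0
    · have hxV := (Finset.mem_erase.1 hx).2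
      obtain ⟨z, hz, rfl⟩ := mem_realVertices.1 hxV
      refine ⟨z, ?_, rfl⟩
      change latticeEmb d z ∈ P
      rw [hV]
      exact subset_convexHull ℝ _ hxV
  have hnot : (0 : Fin d → ℝ) ∉ R := Finset.notMem_erase _ _
  have hcard := Set.ncard_le_ncard hsub (hfin.image _)
  rw [Set.ncard_coe_finset, Finset.card_insert_of_notMem hnot,
    Set.ncard_image_of_injective _ (latticeEmb_injective d)] at hcard
  omega

lemma tendsto_ncard_latticePts (hP : IsLatticePolytope d P) :
    Filter.Tendsto (fun m : ℕ => ((latticePts d ((m : ℝ) • P)).ncard : ℝ) / (m : ℝ) ^ d)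
      Filter.atTop (nhds (vol d P)) := by
  have h := tendsto_card_div_pow_atTop_volume P hP.isCompact.isBounded
    hP.isCompact.isClosed.measurableSet (hP.convex.addHaar_frontier volume)
  rw [Fintype.card_fin] at h
  refine h.congr' ?_
  filter_upwards [Filter.eventually_gt_atTop 0] with m hm
  have hm' : (m : ℝ) ≠ 0 := by exact_mod_cast hm.ne'
  have : NeZero m := ⟨hm.ne'⟩
  congr 2
  rw [Nat.card_coe_set_eq, ← Set.ncard_image_of_injective (latticePts d ((m : ℝ) • P))
    ((smul_right_injective (Fin d → ℝ) (inv_ne_zero hm')).comp (latticeEmb_injective d))]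
  congr 1
  ext y
  simp only [Set.mem_inter_iff, Set.mem_image, Function.comp_apply]
  have hemb : ∀ x : Fin d → ℤ, x ∈ latticePts d ((m : ℝ) • P) ↔
      (m : ℝ)⁻¹ • latticeEmb d x ∈ P := fun x =>
    Set.mem_smul_set_iff_inv_smul_mem₀ hm' P (latticeEmb d x)
  constructor
  · rintro ⟨hyP, hy⟩
    have hy' := (BoxIntegral.unitPartition.mem_smul_span_iff (n := m) (v := y)).1 hy
    choose x hx using hy'
    have hxy : (m : ℝ)⁻¹ • latticeEmb d x = y := by
      funext i
      have hi : ((x i : ℤ) : ℝ) = m * y i := hx i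
      change (m : ℝ)⁻¹ * (x i : ℝ) = y i
      rw [hi, inv_mul_cancel_left₀ hm']
    exact ⟨x, (hemb x).2 (hxy ▸ hyP), hxy⟩
  · rintro ⟨x, hx, rfl⟩
    refine ⟨(hemb x).1 hx, ?_⟩
    refine (BoxIntegral.unitPartition.mem_smul_span_iff (n := m)).2 fun i => ⟨x i, ?_⟩
    change ((x i : ℤ) : ℝ) = m * ((m : ℝ)⁻¹ * (x i : ℝ))
    rw [mul_inv_cancel_left₀ hm']

end LatticeCount

section Quartic

/-- The polynomial `t ↦ (t + j).choose 4`. -/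
def shiftedChooseFour (j : ℕ) : ℚ[X] :=
  C (1 / 24) * ((X + C (j : ℚ)) * (X + C ((j : ℚ) - 1)) * (X + C ((j : ℚ) - 2)) *
    (X + C ((j : ℚ) - 3)))

lemma cast_choose_four (n : ℕ) :
    ((n.choose 4 : ℕ) : ℚ) = 1 / 24 * (n * (n - 1) * (n - 2) * (n - 3)) := by
  have h := Nat.cast_choose_eq_descPochhammer_div ℚ n 4
  rw [h]
  simp [descPochhammer_succ_right, Nat.factorial]
  ring

lemma eval_shiftedChooseFour (j m : ℕ) :
    (shiftedChooseFour j).eval (m : ℚ) = ((m + j).choose 4 : ℕ) := by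
  rw [cast_choose_four]
  simp only [shiftedChooseFour, eval_mul, eval_add, eval_X, eval_C]
  push_cast
  ring

lemma eval_shiftedChooseFour_reflect {j : ℕ} (hj : j ≤ 4) (t : ℚ) :
    (shiftedChooseFour (4 - j)).eval (-1 - t) = (shiftedChooseFour j).eval t := by
  simp only [shiftedChooseFour, eval_mul, eval_add, eval_X, eval_C]
  push_cast [hj]
  ring

lemma natDegree_shiftedChooseFour_le (j : ℕ) : (shiftedChooseFour j).natDegree ≤ 4 := by
  unfold shiftedChooseFour
  compute_degree

variable {P : Set (Fin 4 → ℝ)} {L : ℚ[X]}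

/-- Degree bound and functional equation of the Ehrhart polynomial of a reflexive polytope. -/
lemma IsEhrhart.natDegree_le_and_reflect (hP : IsLatticePolytope 4 P) (hdim : IsFullDim 4 P)
    (href : IsReflexive 4 P) (hL : IsEhrhart 4 P L) :
    L.natDegree ≤ 4 ∧ ∀ t : ℚ, L.eval (-1 - t) = L.eval t := by
  obtain ⟨β, _, k, hk, hcount⟩ := exists_symmetric_binomial_expansion hP hdim href
  have hinf : (Set.range fun m : ℕ => ((m + 1 : ℕ) : ℚ)).Infinite :=
    Set.infinite_range_of_injective fun a b h => by simpa using h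
  have h₁ : L = ∑ b, shiftedChooseFour (4 - k b) := by
    refine eq_of_infinite_eval_eq _ _ (hinf.mono ?_)
    rintro _ ⟨m, rfl⟩
    change L.eval _ = eval _ _
    rw [hL (m + 1), (hcount (m + 1) m.succ_pos).1, eval_finsetSum]
    push_cast [← eval_shiftedChooseFour]
    rfl
  have h₂ : L = ∑ b, shiftedChooseFour (k b) := by
    refine eq_of_infinite_eval_eq _ _ (hinf.mono ?_)
    rintro _ ⟨m, rfl⟩
    change L.eval _ = eval _ _
    rw [hL (m + 1), (hcount (m + 1) m.succ_pos).2, eval_finsetSum]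
    push_cast [← eval_shiftedChooseFour]
    rfl
  refine ⟨h₁ ▸ natDegree_sum_le_of_forall_le _ _ fun b _ => natDegree_shiftedChooseFour_le _,
    fun t => ?_⟩
  conv_lhs => rw [h₁]
  conv_rhs => rw [h₂]
  rw [eval_finsetSum, eval_finsetSum]
  exact Finset.sum_congr rfl fun b _ => eval_shiftedChooseFour_reflect (hk b) t

lemma eval_eq_of_natDegree_le_four (hdeg : L.natDegree ≤ 4) (t : ℚ) :
    L.eval t = L.coeff 0 + L.coeff 1 * t + L.coeff 2 * t ^ 2 + L.coeff 3 * t ^ 3 +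
      L.coeff 4 * t ^ 4 := by
  rw [eval_eq_sum_range' (Nat.lt_succ_of_le hdeg)]
  simp [Finset.sum_range_succ]

lemma IsEhrhart.coeff_four_eq_vol (hP : IsLatticePolytope 4 P) (hL : IsEhrhart 4 P L)
    (hdeg : L.natDegree ≤ 4) : ((L.coeff 4 : ℚ) : ℝ) = vol 4 P := by
  refine tendsto_nhds_unique ?_ (tendsto_ncard_latticePts hP)
  have hinv := tendsto_inv_atTop_nhds_zero_nat (𝕜 := ℝ)
  have hlim : Filter.Tendsto (fun m : ℕ => (L.coeff 0 : ℝ) * ((m : ℝ)⁻¹) ^ 4 +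
      L.coeff 1 * ((m : ℝ)⁻¹) ^ 3 + L.coeff 2 * ((m : ℝ)⁻¹) ^ 2 + L.coeff 3 * (m : ℝ)⁻¹ +
      L.coeff 4) Filter.atTop (nhds ((L.coeff 0 : ℝ) * 0 ^ 4 +
      L.coeff 1 * 0 ^ 3 + L.coeff 2 * 0 ^ 2 + L.coeff 3 * 0 + L.coeff 4)) :=
    (((((hinv.pow 4).const_mul _).add ((hinv.pow 3).const_mul _)).add
      ((hinv.pow 2).const_mul _)).add (hinv.const_mul _)).add tendsto_const_nhds
  have hz : ((L.coeff 0 : ℝ) * 0 ^ 4 + L.coeff 1 * 0 ^ 3 + L.coeff 2 * 0 ^ 2 +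
      L.coeff 3 * 0 + L.coeff 4) = (L.coeff 4 : ℝ) := by ring
  rw [hz] at hlim
  refine hlim.congr' ?_
  filter_upwards [Filter.eventually_gt_atTop 0] with m hm
  have hm' : (m : ℝ) ≠ 0 := by exact_mod_cast hm.ne'
  have h := hL m
  rw [eval_eq_of_natDegree_le_four hdeg] at h
  have h' : ((latticePts 4 ((m : ℝ) • P)).ncard : ℝ) = L.coeff 0 + L.coeff 1 * m +
      L.coeff 2 * m ^ 2 + L.coeff 3 * m ^ 3 + L.coeff 4 * m ^ 4 := by
    exact_mod_cast congrArg (fun x : ℚ => (x : ℝ)) h.symm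
  rw [h']
  field_simp

/-- A real-rooted quartic `a (t + 1/2)⁴ + b (t + 1/2)² + c` has `b ≤ 0` and `b² ≥ 4ac`. -/
lemma IsRealRooted.biquadratic {a b c : ℚ} (ha : 0 < a)
    (hreal : IsRealRooted L) (hne : L ≠ 0)
    (hL : ∀ z : ℂ, (L.map (algebraMap ℚ ℂ)).eval z =
      a * (z + 1 / 2) ^ 4 + b * (z + 1 / 2) ^ 2 + c) :
    b ≤ 0 ∧ 4 * a * c ≤ b ^ 2 := by
  have haC : (a : ℂ) ≠ 0 := by exact_mod_cast ha.ne'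
  have hroot : ∀ u : ℂ, a * u ^ 2 + b * u + c = 0 → ∃ r : ℝ, 0 ≤ r ∧ u = r := by
    intro u hu
    obtain ⟨z, hz⟩ := IsAlgClosed.exists_pow_nat_eq u (n := 2) two_pos
    have hmem : z - 1 / 2 ∈ cRoots L := by
      rw [cRoots, mem_roots (Polynomial.map_ne_zero hne), IsRoot, hL, ← hu, ← hz]
      ring
    have him : z.im = 0 := by simpa using hreal _ hmem
    refine ⟨z.re ^ 2, sq_nonneg _, ?_⟩
    have hzre : z = (z.re : ℂ) := Complex.ext rfl (by simpa using him)
    rw [← hz]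
    conv_lhs => rw [hzre]
    push_cast
    rfl
  obtain ⟨s, hs⟩ := IsAlgClosed.exists_pow_nat_eq ((b : ℂ) ^ 2 - 4 * a * c) (n := 2) two_pos
  obtain ⟨r₁, h₁, hr₁⟩ := hroot ((-b + s) / (2 * a)) (by
    field_simp
    linear_combination hs)
  obtain ⟨r₂, h₂, hr₂⟩ := hroot ((-b - s) / (2 * a)) (by
    field_simp
    linear_combination hs)
  have hsum : (b : ℝ) = -a * (r₁ + r₂) := by
    have : (b : ℂ) = -a * (r₁ + r₂) := by
      rw [← hr₁, ← hr₂]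
      field_simp
      ring
    exact_mod_cast this
  have hdisc : (b : ℝ) ^ 2 - 4 * a * c = (a * (r₁ - r₂)) ^ 2 := by
    have : (b : ℂ) ^ 2 - 4 * a * c = (a * (r₁ - r₂)) ^ 2 := by
      rw [← hr₁, ← hr₂, ← hs]
      field_simp
      ring
    exact_mod_cast this
  have haR : (0 : ℝ) < a := by exact_mod_cast ha
  constructor
  · have : (b : ℝ) ≤ 0 := by
      rw [hsum]
      nlinarith [mul_nonneg haR.le (add_nonneg h₁ h₂)]
    exact_mod_cast this
  · have : 4 * (a : ℝ) * c ≤ (b : ℝ) ^ 2 := by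
      linarith [sq_nonneg ((a : ℝ) * (r₁ - r₂))]
    exact_mod_cast this

/-- The numerical core: `n = 24a`, `N` is the number of lattice points. -/
lemma three_le_of_discriminant {a b c : ℚ} {n : ℤ} {N : ℚ} (ha : 0 < a) (hn : 24 * a = n)
    (h0 : a / 16 + b / 4 + c = 1) (h1 : 81 * a / 16 + 9 * b / 4 + c = N) (hN : 6 ≤ N)
    (hb : b ≤ 0) (hdisc : 4 * a * c ≤ b ^ 2) : 3 ≤ a := by
  have hbN : 2 * b = N - 1 - 5 * a := by linarith
  have hc : c = 1 - a / 16 - b / 4 := by linarith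
  have hsq : 16 * a ≤ (N - 1 - 4 * a) ^ 2 := by
    have : N - 1 - 4 * a = 2 * b + a := by linarith
    rw [this]
    subst hc
    nlinarith
  by_contra! hlt
  rcases le_or_gt 0 (N - 1 - 4 * a) with h | h
  · have h5 : N - 1 - 4 * a ≤ a := by linarith
    nlinarith
  · have h5 : (N - 1 - 4 * a) ^ 2 ≤ (4 * a - 5) ^ 2 := by
      apply sq_le_sq'
      · linarith
      · linarith
    have hn72 : n < 72 := by
      have : (n : ℚ) < 72 := by linarith
      exact_mod_cast this
    have hn71 : (n : ℚ) ≤ 71 := by exact_mod_cast Int.le_of_lt_add_one hn72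
    have ha71 : a ≤ 71 / 24 := by linarith
    have ha5 : 5 / 4 < a := by linarith
    nlinarith

end Quartic

theorem statement9 (P : Set (Fin 4 → ℝ)) (L : Polynomial ℚ)
    (hP : IsLatticePolytope 4 P) (hdim : IsFullDim 4 P) (href : IsReflexive 4 P)
    (hL : IsEhrhart 4 P L) (hreal : IsRealRooted L) :
    3 ≤ vol 4 P := by
  obtain ⟨hdeg, hsymm⟩ := hL.natDegree_le_and_reflect hP hdim href
  have heval := eval_eq_of_natDegree_le_four hdeg
  have hvol := hL.coeff_four_eq_vol hP hdeg
  have hvolpos : 0 < vol 4 P :=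
    ENNReal.toReal_pos (Measure.measure_pos_of_nonempty_interior _ ⟨0, href.1⟩).ne'
      hP.isCompact.measure_lt_top.ne
  set a := L.coeff 4 with ha_def
  have ha : 0 < a := by
    rw [← hvol] at hvolpos
    exact_mod_cast hvolpos
  have hL0 : L.eval 0 = 1 := by
    have h := hL 0
    rw [Nat.cast_zero, Nat.cast_zero, Set.zero_smul_set ⟨0, interior_subset href.1⟩] at h
    have hpts : latticePts 4 (0 : Set (Fin 4 → ℝ)) = {0} := by
      ext x
      change latticeEmb 4 x = 0 ↔ x = 0
      exact map_eq_zero_iff _ (latticeEmb_injective 4)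
    rw [hpts, Set.ncard_singleton] at h
    simpa using h
  have hL1 : 6 ≤ L.eval 1 := by
    have h := hL 1
    rw [Nat.cast_one, Nat.cast_one, one_smul] at h
    rw [h]
    exact_mod_cast add_two_le_ncard_latticePts hP hdim href.1
  have hs0 := hsymm 0
  have hs1 := hsymm 1
  rw [heval, heval] at hs0 hs1
  have hc3 : L.coeff 3 = 2 * a := by linarith
  have hc1 : L.coeff 1 = L.coeff 2 - a := by linarith
  rw [heval] at hL0
  have hn : ∃ n : ℤ, 24 * a = n := by
    have h0 := hL 0
    have h1 := hL 1
    have h2 := hL 2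
    have h3 := hL 3
    have h4 := hL 4
    rw [heval] at h0 h1 h2 h3 h4
    refine ⟨((latticePts 4 (((4 : ℕ) : ℝ) • P)).ncard : ℤ) -
      4 * (latticePts 4 (((3 : ℕ) : ℝ) • P)).ncard +
      6 * (latticePts 4 (((2 : ℕ) : ℝ) • P)).ncard -
      4 * (latticePts 4 (((1 : ℕ) : ℝ) • P)).ncard +
      (latticePts 4 (((0 : ℕ) : ℝ) • P)).ncard, ?_⟩
    push_cast at h0 h1 h2 h3 h4 ⊢
    linarith
  obtain ⟨n, hn⟩ := hn
  have hne : L ≠ 0 := by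
    rintro rfl
    simp [ha_def] at ha
  -- `L = a (t + 1/2)⁴ + b (t + 1/2)² + c`
  set b := L.coeff 2 - 3 / 2 * a with hb_def
  set c := 1 - a / 16 - b / 4 with hc_def
  have hmap : ∀ z : ℂ, (L.map (algebraMap ℚ ℂ)).eval z =
      a * (z + 1 / 2) ^ 4 + b * (z + 1 / 2) ^ 2 + c := by
    intro z
    have hlt : (L.map (algebraMap ℚ ℂ)).natDegree < 5 :=
      Nat.lt_succ_of_le ((natDegree_map_le).trans hdeg)
    have h0 : L.coeff 0 = 1 := by linarith
    rw [eval_eq_sum_range' hlt]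
    simp only [Finset.sum_range_succ, Finset.sum_range_zero, coeff_map, h0, hc1, hc3, hc_def,
      hb_def, ← ha_def, eq_ratCast]
    push_cast
    ring
  obtain ⟨hb, hdisc⟩ := hreal.biquadratic ha hne hmap
  have h3 : 3 ≤ a := by
    refine three_le_of_discriminant (N := L.eval 1) ha hn (by rw [hc_def]; ring) ?_ hL1 hb hdisc
    rw [heval, hc3, hc1, hc_def, hb_def]
    linarith
  rw [← hvol]
  exact_mod_cast h3
end
end
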